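/- arXiv:0908.3159 — 5 statements merged into one kernel-verified Lean document; each statement's English description precedes it below -/
import Mathlib

section
/- Let P ⋈ Q be the wedge product of polytopes P and Q with m resp. m' facets. A vector (H_0, …, H_{m−1}) with H_i ⊆ [m'] corresponds to a vertex of P ⋈ Q if and only if: (i) the set {i ∈ [m] : H_i = [m']} corresponds to a vertex of P (i.e. is the set of facet indices of a vertex of P), and (ii) each H_i with H_i ≠ [m'] corresponds to a vertex of Q (i.e. is the set of facet indices of a vertex of Q). -/
open Matrix Set

noncomputable section

def setDim {V : Type*} [AddCommGroup V] [Module ℝ V] (s : Set V) : ℕ :=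
  Module.finrank ℝ (affineSpan ℝ s).direction

def IsFaceOf {V : Type*} [AddCommGroup V] [Module ℝ V] (F P : Set V) : Prop :=
  F ⊆ P ∧ ∃ (c : V →ₗ[ℝ] ℝ) (b : ℝ), (∀ x ∈ P, c x ≤ b) ∧ F = {x ∈ P | c x = b}

def IsVertexOf {V : Type*} [AddCommGroup V] [Module ℝ V] (v : V) (P : Set V) : Prop :=
  IsFaceOf {v} P

def IsFacetOf {V : Type*} [AddCommGroup V] [Module ℝ V] (F P : Set V) : Prop :=
  IsFaceOf F P ∧ F.Nonempty ∧ setDim F + 1 = setDim P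

/-- A point `v` of the polyhedron `{x | ∀ i, l i x ≤ 1}` is a vertex iff no nonzero direction is
annihilated by all the constraints that are tight at `v`. -/
theorem isVertexOf_iff_tight {V ι : Type*} [AddCommGroup V] [Module ℝ V] [Finite ι]
    {l : ι → V → ℝ} (hl : ∀ i, IsLinearMap ℝ (l i)) (v : V) :
    IsVertexOf v {x | ∀ i, l i x ≤ 1} ↔
      (∀ i, l i v ≤ 1) ∧ ∀ e, (∀ i, l i v = 1 → l i e = 0) → e = 0 := by
  classical
  have := Fintype.ofFinite ι
  constructor
  · rintro ⟨hsub, c, b, hc, hF⟩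
    have hv : ∀ i, l i v ≤ 1 := hsub rfl
    have hcv : c v = b := (hF.subset rfl).2
    refine ⟨hv, fun e he => ?_⟩
    have hev : ∀ᶠ t in nhds (0 : ℝ), ∀ i, l i v + t * l i e ≤ 1 ∧ l i v - t * l i e ≤ 1 := by
      refine Filter.eventually_all.2 fun i => ?_
      rcases (hv i).eq_or_lt with h | h
      · simp [h, he i h]
      · have h₁ : Filter.Tendsto (fun t : ℝ => l i v + t * l i e) (nhds 0) (nhds (l i v)) := by
          have : Continuous fun t : ℝ => l i v + t * l i e := by fun_prop
          simpa using this.tendsto 0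
        have h₂ : Filter.Tendsto (fun t : ℝ => l i v - t * l i e) (nhds 0) (nhds (l i v)) := by
          have : Continuous fun t : ℝ => l i v - t * l i e := by fun_prop
          simpa using this.tendsto 0
        filter_upwards [h₁.eventually_lt_const h, h₂.eventually_lt_const h] with t a b
        exact ⟨a.le, b.le⟩
    obtain ⟨t, ht, htpos⟩ :=
      ((hev.filter_mono nhdsWithin_le_nhds).and
        (self_mem_nhdsWithin : Set.Ioi (0 : ℝ) ∈ nhdsWithin 0 (Set.Ioi 0))).exists
    have hpos : (0 : ℝ) < t := htpos
    have hplus : v + t • e ∈ {x | ∀ i, l i x ≤ 1} := fun i => by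
      simpa [(hl i).map_add, (hl i).map_smul] using (ht i).1
    have hminus : v - t • e ∈ {x | ∀ i, l i x ≤ 1} := fun i => by
      simpa [(hl i).map_sub, (hl i).map_smul] using (ht i).2
    have h₁ := hc _ hplus
    have h₂ := hc _ hminus
    have h₃ : v + t • e ∈ ({v} : Set V) := by
      rw [hF]
      refine ⟨hplus, le_antisymm h₁ ?_⟩
      rw [map_sub] at h₂
      rw [map_add] at h₁ ⊢
      linarith
    simpa [hpos.ne'] using h₃
  · rintro ⟨hv, hd⟩
    let s : Finset ι := Finset.univ.filter fun i => l i v = 1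
    refine ⟨by simpa using hv, ∑ i ∈ s, (hl i).mk' (l i), ∑ i ∈ s, 1, ?_, ?_⟩
    · intro x hx
      simp only [LinearMap.sum_apply, IsLinearMap.mk'_apply]
      exact Finset.sum_le_sum fun i _ => hx i
    · ext x
      simp only [LinearMap.sum_apply, IsLinearMap.mk'_apply, Set.mem_singleton_iff,
        Set.mem_ofPred_eq]
      constructor
      · rintro rfl
        exact ⟨hv, Finset.sum_congr rfl fun i hi => (Finset.mem_filter.1 hi).2⟩
      · rintro ⟨hx, hsum⟩
        have h := (Finset.sum_eq_sum_iff_of_le fun i _ => hx i).1 hsum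
        refine sub_eq_zero.1 (hd (x - v) fun i hi => ?_)
        rw [(hl i).map_sub, hi, h i (by simp [s, hi]), sub_self]

/-- A bounded polyhedron `{x | ∀ i, A i ⬝ᵥ x ≤ 1}` has trivial recession cone. -/
theorem eq_zero_of_dotProduct_nonpos {ι κ : Type*} [Fintype κ] {A : ι → κ → ℝ}
    (hbd : Bornology.IsBounded {x | ∀ i, A i ⬝ᵥ x ≤ 1}) {e : κ → ℝ}
    (he : ∀ i, A i ⬝ᵥ e ≤ 0) : e = 0 := by
  obtain ⟨C, hC⟩ := hbd.exists_norm_le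
  by_contra hne
  have hpos : 0 < ‖e‖ := norm_pos_iff.2 hne
  have hC0 : 0 ≤ C := (norm_nonneg 0).trans (hC 0 fun i => by simp)
  have h := hC (((C + 1) / ‖e‖) • e) fun i => by
    rw [dotProduct_smul, smul_eq_mul]
    exact (mul_nonpos_of_nonneg_of_nonpos (by positivity) (he i)).trans zero_le_one
  rw [norm_smul, Real.norm_of_nonneg (by positivity), div_mul_cancel₀ _ hpos.ne'] at h
  linarith

theorem isLinearMap_dotProduct {κ : Type*} [Fintype κ] (a : κ → ℝ) :
    IsLinearMap ℝ fun x => a ⬝ᵥ x :=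
  ⟨fun x y => dotProduct_add a x y, fun c x => dotProduct_smul c a x⟩

/-- A vector `(H_0, …, H_{m-1})` with `H_i ⊆ [m']` corresponds to a
vertex of the wedge product `W = P ⋈ Q` (i.e. there is a vertex `u` of `W` such that
`H_i` is exactly the set of `j` with `u ∈ h_{i,j}`) if and only if the set
`{i | H_i = [m']}` is the set of facet indices of a vertex of `P` and every `H_i ≠ [m']`
is the set of facet indices of a vertex of `Q`. -/
theorem wedgeProduct_vertex_characterization
    (d d' m m' : ℕ)
    (A : Fin m → Fin d → ℝ) (B : Fin m' → Fin d' → ℝ)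
    (P : Set (Fin d → ℝ)) (hP : P = {x | ∀ i, A i ⬝ᵥ x ≤ 1})
    (Q : Set (Fin d' → ℝ)) (hQ : Q = {y | ∀ j, B j ⬝ᵥ y ≤ 1})
    (hPbd : Bornology.IsBounded P) (hPdim : setDim P = d)
    (hPfacets : ∀ i, IsFacetOf {x ∈ P | A i ⬝ᵥ x = 1} P)
    (hPinj : Function.Injective fun i => {x ∈ P | A i ⬝ᵥ x = 1})
    (hPall : ∀ G, IsFacetOf G P → ∃ i, G = {x ∈ P | A i ⬝ᵥ x = 1})
    (hQbd : Bornology.IsBounded Q) (hQdim : setDim Q = d')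
    (hQfacets : ∀ j, IsFacetOf {y ∈ Q | B j ⬝ᵥ y = 1} Q)
    (hQinj : Function.Injective fun j => {y ∈ Q | B j ⬝ᵥ y = 1})
    (hQall : ∀ G, IsFacetOf G Q → ∃ j, G = {y ∈ Q | B j ⬝ᵥ y = 1})
    (W : Set ((Fin d → ℝ) × (Fin m → Fin d' → ℝ)))
    (hW : W = {z | ∀ i j, A i ⬝ᵥ z.1 + B j ⬝ᵥ z.2 i ≤ 1})
    -- a vector `(H_0, …, H_{m-1})` of subsets of `[m']`:
    (H : Fin m → Set (Fin m')) :
    (∃ u, IsVertexOf u W ∧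
        ∀ i, H i = {j | A i ⬝ᵥ u.1 + B j ⬝ᵥ u.2 i = 1}) ↔
      ((∃ v, IsVertexOf v P ∧ {i | H i = Set.univ} = {i | A i ⬝ᵥ v = 1}) ∧
       (∀ i, H i ≠ Set.univ →
          ∃ w, IsVertexOf w Q ∧ H i = {j | B j ⬝ᵥ w = 1})) := by
  subst hP hQ hW
  have hW : {z : (Fin d → ℝ) × (Fin m → Fin d' → ℝ) |
      ∀ i j, A i ⬝ᵥ z.1 + B j ⬝ᵥ z.2 i ≤ 1} =
      {z | ∀ p : Fin m × Fin m', A p.1 ⬝ᵥ z.1 + B p.2 ⬝ᵥ z.2 p.1 ≤ 1} := by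
    ext z
    simp [Prod.forall]
  have hlW : ∀ p : Fin m × Fin m', IsLinearMap ℝ
      fun z : (Fin d → ℝ) × (Fin m → Fin d' → ℝ) => A p.1 ⬝ᵥ z.1 + B p.2 ⬝ᵥ z.2 p.1 := fun p =>
    ⟨fun x y => by simp [dotProduct_add]; ring, fun c x => by simp [dotProduct_smul]; ring⟩
  simp only [hW, isVertexOf_iff_tight hlW,
    isVertexOf_iff_tight fun i => isLinearMap_dotProduct (A i),
    isVertexOf_iff_tight fun j => isLinearMap_dotProduct (B j), Prod.forall]
  constructor
  · rintro ⟨⟨x, y⟩, ⟨hxy, hvert⟩, hH⟩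
    simp only at hxy hvert hH
    have hne (i : Fin m) : Nonempty (Fin m') := by
      by_contra hemp
      rw [not_nonempty_iff] at hemp
      obtain ⟨z, -, hz⟩ := (hPfacets i).2.1
      have hz0 : z = 0 := congrArg Prod.fst (hvert z 0 fun _ j => hemp.elim j)
      simp [hz0] at hz
    have hx (i : Fin m) : A i ⬝ᵥ x ≤ 1 := by
      by_contra! hlt
      obtain ⟨j⟩ := hne i
      have hy : y i = 0 := eq_zero_of_dotProduct_nonpos hQbd fun j => by linarith [hxy i j]
      have := hxy i j
      rw [hy, dotProduct_zero] at this
      linarith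
    have htight (i : Fin m) (hi : A i ⬝ᵥ x = 1) : y i = 0 :=
      eq_zero_of_dotProduct_nonpos hQbd fun j => by linarith [hxy i j]
    have huniv (i : Fin m) : H i = Set.univ ↔ A i ⬝ᵥ x = 1 := by
      constructor
      · intro hi
        have hall (j : Fin m') : A i ⬝ᵥ x + B j ⬝ᵥ y i = 1 := by
          have : j ∈ H i := hi ▸ Set.mem_univ j
          rwa [hH i] at this
        obtain ⟨j⟩ := hne i
        have hy : -y i = 0 := eq_zero_of_dotProduct_nonpos hQbd fun j => by
          rw [dotProduct_neg]
          linarith [hall j, hx i]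
        simpa [neg_eq_zero.1 hy] using hall j
      · intro hi
        rw [hH i]
        ext j
        simp [hi, htight i hi]
    refine ⟨⟨x, ⟨hx, fun e he => ?_⟩, Set.ext huniv⟩, fun i hi => ?_⟩
    · refine congrArg Prod.fst
        (hvert e (fun i => (-(A i ⬝ᵥ e) / (1 - A i ⬝ᵥ x)) • y i) fun i j hij => ?_)
      simp only [dotProduct_smul, smul_eq_mul]
      by_cases h : A i ⬝ᵥ x = 1
      · simp [h, he i h]
      · have h' : 1 - A i ⬝ᵥ x ≠ 0 := sub_ne_zero.2 (Ne.symm h)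
        rw [show B j ⬝ᵥ y i = 1 - A i ⬝ᵥ x by linarith]
        field_simp
        ring
    · have hlt : 0 < 1 - A i ⬝ᵥ x :=
        sub_pos.2 ((hx i).lt_of_ne fun h => hi ((huniv i).2 h))
      have hw (j : Fin m') : B j ⬝ᵥ ((1 - A i ⬝ᵥ x)⁻¹ • y i) = 1 ↔
          A i ⬝ᵥ x + B j ⬝ᵥ y i = 1 := by
        rw [dotProduct_smul, smul_eq_mul, inv_mul_eq_one₀ hlt.ne']
        constructor <;> intro h <;> linarith
      refine ⟨(1 - A i ⬝ᵥ x)⁻¹ • y i, ⟨fun j => ?_, fun f hf => ?_⟩, ?_⟩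
      · rw [dotProduct_smul, smul_eq_mul, inv_mul_le_iff₀ hlt]
        linarith [hxy i j]
      · have h := congrArg Prod.snd (hvert 0 (Pi.single i f) fun k j hkj => ?_)
        · simpa using congrFun h i
        · by_cases hki : k = i
          · subst hki
            simpa using hf j ((hw j).2 hkj)
          · simp [Pi.single_eq_of_ne hki]
      · rw [hH i]
        exact Set.ext fun j => (hw j).symm
  · rintro ⟨⟨v, ⟨hv, hvert⟩, hHv⟩, hQv⟩
    have huniv (i : Fin m) : H i = Set.univ ↔ A i ⬝ᵥ v = 1 := Set.ext_iff.1 hHv i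
    have hex (i : Fin m) : ∃ w : Fin d' → ℝ, H i ≠ Set.univ →
        ((∀ j, B j ⬝ᵥ w ≤ 1) ∧ ∀ e, (∀ j, B j ⬝ᵥ w = 1 → B j ⬝ᵥ e = 0) → e = 0) ∧
          H i = {j | B j ⬝ᵥ w = 1} := by
      by_cases hi : H i = Set.univ
      · exact ⟨0, fun h => (h hi).elim⟩
      · obtain ⟨w, hw⟩ := hQv i hi
        exact ⟨w, fun _ => hw⟩
    choose w hw using hex
    have hmem (i : Fin m) (j : Fin m') :
        j ∈ H i ↔ A i ⬝ᵥ v + B j ⬝ᵥ ((1 - A i ⬝ᵥ v) • w i) = 1 := by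
      by_cases hi : H i = Set.univ
      · simp [hi, (huniv i).1 hi]
      · have hne : 1 - A i ⬝ᵥ v ≠ 0 := sub_ne_zero.2 fun h => hi ((huniv i).2 h.symm)
        rw [(hw i hi).2, Set.mem_ofPred_eq, dotProduct_smul, smul_eq_mul]
        constructor
        · intro h
          rw [h]
          ring
        · intro h
          exact mul_left_cancel₀ hne (by linarith)
    refine ⟨(v, fun i => (1 - A i ⬝ᵥ v) • w i), ⟨fun i j => ?_, ?_⟩,
      fun i => Set.ext fun j => hmem i j⟩
    · by_cases hi : H i = Set.univ
      · simp [(huniv i).1 hi]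
      · simp only [dotProduct_smul, smul_eq_mul]
        nlinarith [mul_nonneg (sub_nonneg.2 (hv i)) (sub_nonneg.2 ((hw i hi).1.1 j))]
    · intro e f hef
      replace hef (i : Fin m) (j : Fin m') (hj : j ∈ H i) : A i ⬝ᵥ e + B j ⬝ᵥ f i = 0 :=
        hef i j ((hmem i j).1 hj)
      have hf (i : Fin m) (hi : H i = Set.univ) : f i = 0 := by
        have hall (j : Fin m') : A i ⬝ᵥ e + B j ⬝ᵥ f i = 0 := hef i j (hi ▸ Set.mem_univ j)
        rcases le_total 0 (A i ⬝ᵥ e) with h | h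
        · exact eq_zero_of_dotProduct_nonpos hQbd fun j => by linarith [hall j]
        · refine neg_eq_zero.1 (eq_zero_of_dotProduct_nonpos hQbd fun j => ?_)
          rw [dotProduct_neg]
          linarith [hall j]
      have he : e = 0 := hvert e fun i hi => by
        have hHi := (huniv i).2 hi
        rcases isEmpty_or_nonempty (Fin m') with hemp | ⟨⟨j⟩⟩
        · have hv0 : -v = 0 := eq_zero_of_dotProduct_nonpos hPbd fun k => by
            rw [dotProduct_neg, (huniv k).1 (Subsingleton.elim _ _)]
            norm_num
          simp [neg_eq_zero.1 hv0] at hi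
        · simpa [hf i hHi] using hef i j (hHi ▸ Set.mem_univ j)
      subst he
      refine Prod.ext rfl (funext fun i => ?_)
      by_cases hi : H i = Set.univ
      · exact hf i hi
      · refine (hw i hi).1.2 (f i) fun j hj => ?_
        have : j ∈ H i := by
          rw [(hw i hi).2]
          exact hj
        simpa using hef i j this
end
end

section
/- Let W_{p,q−1} = C_p ⋈ Δ_{q−1} be the wedge product of a p-gon (p ≥ 3, facets labeled cyclically by Z_p) and a (q−1)-simplex (q ≥ 1, facets labeled by Z_q). Then the vertices of W_{p,q−1} correspond exactly to the vectors (H_0, …, H_{p−1}) with H_i ⊆ Z_q that have two cyclically adjacent entries equal to Z_q while all other entries are (q−1)-element subsets of Z_q (i.e. of the form j̄ = Z_q \ {j}). In particular, the number of vertices of W_{p,q−1} is p·q^{p−2}. -/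
open Matrix Set

noncomputable section

section Polyhedron

variable {V : Type*} [AddCommGroup V] [Module ℝ V] {ι : Type*} [Finite ι]

/-- A direction annihilated by all constraints that are tight at a vertex is zero. -/
theorem IsVertexOf.eq_zero_of_tight {f : ι → V →ₗ[ℝ] ℝ} {u d : V}
    (hu : IsVertexOf u {z | ∀ e, f e z ≤ 1}) (hd : ∀ e, f e u = 1 → f e d = 0) : d = 0 := by
  obtain ⟨hsub, c, r, hc, heq⟩ := hu
  have huW : ∀ e, f e u ≤ 1 := hsub rfl
  have hcu : c u = r := (heq.subset rfl).2
  have hε : ∀ᶠ t : ℝ in nhds 0, ∀ e, f e u + t * f e d ≤ 1 := by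
    rw [Filter.eventually_all]
    intro e
    rcases (huW e).eq_or_lt with h | h
    · simp [hd e h, h]
    · have hcont : ContinuousAt (fun t : ℝ => f e u + t * f e d) 0 := by fun_prop
      filter_upwards [hcont.eventually_lt continuousAt_const (show _ < (1 : ℝ) by simpa using h)]
        with t ht using ht.le
  obtain ⟨ε, hεpos, hball⟩ := Metric.eventually_nhds_iff.mp hε
  have hmem : ∀ t : ℝ, |t| < ε → u + t • d ∈ {z | ∀ e, f e z ≤ 1} := fun t ht e => by
    simpa using hball (show dist t 0 < ε by simpa using ht) e
  have habs : |ε / 2| < ε := by rw [abs_of_pos] <;> linarith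
  have h1 := hc _ (hmem (ε / 2) habs)
  have h2 := hc _ (hmem (-(ε / 2)) (by rwa [abs_neg]))
  simp only [map_add, map_smul, smul_eq_mul, hcu] at h1 h2
  have hmem' : u + (ε / 2) • d ∈ ({u} : Set V) := by
    rw [heq]
    refine ⟨hmem _ habs, ?_⟩
    simp only [map_add, map_smul, smul_eq_mul, hcu]
    linarith
  have hzero : (ε / 2) • d = 0 := by simpa using hmem'
  exact (smul_eq_zero.mp hzero).resolve_left (by positivity)

/-- A point of a polyhedron determined by its tight constraints is a vertex. -/
theorem isVertexOf_of_forall_tight_eq {f : ι → V →ₗ[ℝ] ℝ} {u : V}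
    (hu : ∀ e, f e u ≤ 1)
    (huniq : ∀ z, (∀ e, f e z ≤ 1) → (∀ e, f e u = 1 → f e z = 1) → z = u) :
    IsVertexOf u {z | ∀ e, f e z ≤ 1} := by
  classical
  have := Fintype.ofFinite ι
  set T : Finset ι := Finset.univ.filter fun e => f e u = 1 with hT
  have hsum : ∀ z, (∑ e ∈ T, f e) z = ∑ e ∈ T, f e z := fun z => by simp
  refine ⟨Set.singleton_subset_iff.mpr hu, ∑ e ∈ T, f e, ∑ _e ∈ T, 1, fun z hz => ?_, ?_⟩
  · rw [hsum]
    exact Finset.sum_le_sum fun e _ => hz e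
  · ext z
    constructor
    · rintro rfl
      exact ⟨hu, by rw [hsum]; exact Finset.sum_congr rfl fun e he => by simpa [hT] using he⟩
    · rintro ⟨hz, hcz⟩
      rw [hsum, Finset.sum_eq_sum_iff_of_le fun e _ => hz e] at hcz
      exact huniq z hz fun e he => hcz e (by simpa [hT] using he)

end Polyhedron

/-- The recession cone of a bounded polyhedron is trivial. -/
theorem eq_zero_of_forall_dotProduct_nonpos {ι : Type*} {n : ℕ} {a : ι → Fin n → ℝ}
    (hbd : Bornology.IsBounded {x | ∀ i, a i ⬝ᵥ x ≤ 1}) {d : Fin n → ℝ}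
    (hd : ∀ i, a i ⬝ᵥ d ≤ 0) : d = 0 := by
  obtain ⟨R, hR⟩ := hbd.exists_norm_le
  by_contra hne
  have hpos : 0 < ‖d‖ := norm_pos_iff.mpr hne
  have hmem : ((|R| + 1) / ‖d‖) • d ∈ {x | ∀ i, a i ⬝ᵥ x ≤ 1} := fun i => by
    rw [dotProduct_smul, smul_eq_mul]
    exact (mul_nonpos_of_nonneg_of_nonpos (by positivity) (hd i)).trans zero_le_one
  have h := hR _ hmem
  rw [norm_smul, Real.norm_of_nonneg (by positivity), div_mul_cancel₀ _ hpos.ne'] at h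
  linarith [le_abs_self R]

/-- The constraints of a bounded nonempty polyhedron cannot all be tight at one point. -/
theorem not_forall_dotProduct_eq_one {ι : Type*} [Nonempty ι] {n : ℕ} {a : ι → Fin n → ℝ}
    (hbd : Bornology.IsBounded {x | ∀ i, a i ⬝ᵥ x ≤ 1}) (x : Fin n → ℝ) :
    ¬ ∀ i, a i ⬝ᵥ x = 1 := by
  intro h
  have hx : -x = 0 := eq_zero_of_forall_dotProduct_nonpos hbd fun i => by
    rw [dotProduct_neg, h i]
    norm_num
  have := h (Classical.arbitrary ι)
  rw [neg_eq_zero.mp hx, dotProduct_zero] at this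
  exact zero_ne_one this

theorem eq_of_dotProduct_eq_of_det_ne_zero {a b x y : Fin 2 → ℝ}
    (hdet : a 0 * b 1 - a 1 * b 0 ≠ 0) (ha : a ⬝ᵥ x = a ⬝ᵥ y) (hb : b ⬝ᵥ x = b ⬝ᵥ y) :
    x = y := by
  simp only [dotProduct, Fin.sum_univ_two] at ha hb
  ext i
  apply mul_left_cancel₀ hdet
  fin_cases i
  · simp only [Fin.zero_eta]
    linear_combination b 1 * ha - a 1 * hb
  · simp only [Fin.mk_one]
    linear_combination a 0 * hb - b 0 * ha

theorem eq_of_dotProduct_eq_one_of_det_eq_zero {a b x : Fin 2 → ℝ}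
    (hdet : a 0 * b 1 - a 1 * b 0 = 0) (ha : a ⬝ᵥ x = 1) (hb : b ⬝ᵥ x = 1) : a = b := by
  simp only [dotProduct, Fin.sum_univ_two] at ha hb
  ext i
  fin_cases i
  · simp only [Fin.zero_eta]
    linear_combination -a 0 * hb + b 0 * ha + x 1 * hdet
  · simp only [Fin.mk_one]
    linear_combination -a 1 * hb + b 1 * ha - x 0 * hdet

/-- The vectors with two cyclically adjacent entries equal to `ZMod q` and all other entries
complements of singletons. -/
def wedgeVertexVectors (p q : ℕ) : Set (ZMod p → Set (ZMod q)) :=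
  {H | ∃ k : ZMod p, H k = Set.univ ∧ H (k + 1) = Set.univ ∧
    ∀ i, i ≠ k → i ≠ k + 1 → ∃ j : ZMod q, H i = {j}ᶜ}

theorem ZMod.natCast_ne_zero_of_lt {p n : ℕ} (hn : 0 < n) (h : n < p) : (n : ZMod p) ≠ 0 := by
  rw [Ne, ZMod.natCast_eq_zero_iff]
  exact fun hdvd => absurd (Nat.le_of_dvd hn hdvd) (by omega)

theorem ncard_wedgeVertexVectors {p q : ℕ} [NeZero p] [NeZero q] (hp : 3 ≤ p) :
    (wedgeVertexVectors p q).ncard = p * q ^ (p - 2) := by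
  classical
  have h1 : (1 : ZMod p) ≠ 0 := by
    simpa using ZMod.natCast_ne_zero_of_lt (p := p) one_pos (by omega)
  have h2 : (2 : ZMod p) ≠ 0 := by
    simpa using ZMod.natCast_ne_zero_of_lt (p := p) two_pos (by omega)
  let Φ : (Σ k : ZMod p, {i : ZMod p // i ≠ k ∧ i ≠ k + 1} → ZMod q) →
      ZMod p → Set (ZMod q) :=
    fun s i => if h : i ≠ s.1 ∧ i ≠ s.1 + 1 then {s.2 ⟨i, h⟩}ᶜ else Set.univ
  have hΦ_univ : ∀ s i, Φ s i = Set.univ ↔ i = s.1 ∨ i = s.1 + 1 := by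
    intro s i
    by_cases h : i ≠ s.1 ∧ i ≠ s.1 + 1
    · simp [Φ, h.1, h.2]
    · simp only [Φ, dif_neg h, true_iff]
      tauto
  have hinj : Function.Injective Φ := by
    rintro ⟨k, g⟩ ⟨k', g'⟩ heq
    have hk : k = k' := by
      have e1 := (hΦ_univ ⟨k', g'⟩ k).mp (heq ▸ (hΦ_univ ⟨k, g⟩ k).mpr (Or.inl rfl))
      have e2 := (hΦ_univ ⟨k', g'⟩ (k + 1)).mp
        (heq ▸ (hΦ_univ ⟨k, g⟩ (k + 1)).mpr (Or.inr rfl))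
      rcases e1 with e1 | e1
      · exact e1
      · rcases e2 with e2 | e2
        · exact absurd (by linear_combination e2 - e1 : (2 : ZMod p) = 0) h2
        · exact add_right_cancel e2
    subst hk
    congr 1
    funext ⟨i, hi⟩
    have := congrFun heq i
    simpa [Φ, hi.1, hi.2] using this
  have hrange : wedgeVertexVectors p q = Set.range Φ := by
    ext H
    constructor
    · rintro ⟨k, hk, hk1, hH⟩
      choose g hg using hH
      refine ⟨⟨k, fun i => g i.1 i.2.1 i.2.2⟩, funext fun i => ?_⟩
      by_cases h : i ≠ k ∧ i ≠ k + 1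
      · simp [Φ, h.1, h.2, hg i h.1 h.2]
      · rw [(hΦ_univ _ i).mpr (by dsimp only; tauto)]
        rcases (by tauto : i = k ∨ i = k + 1) with rfl | rfl
        exacts [hk.symm, hk1.symm]
    · rintro ⟨⟨k, g⟩, rfl⟩
      exact ⟨k, (hΦ_univ _ _).mpr (Or.inl rfl), (hΦ_univ _ _).mpr (Or.inr rfl),
        fun i hi hi' => ⟨g ⟨i, hi, hi'⟩, by simp [Φ, hi, hi']⟩⟩
  have hcard : ∀ k : ZMod p, Fintype.card {i : ZMod p // i ≠ k ∧ i ≠ k + 1} = p - 2 := by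
    intro k
    have hset : (Finset.univ.filter fun i : ZMod p => i ≠ k ∧ i ≠ k + 1) =
        ({k, k + 1} : Finset (ZMod p))ᶜ := by
      ext i
      simp
    rw [Fintype.card_subtype, hset, Finset.card_compl, ZMod.card,
      Finset.card_pair (by simpa using h1)]
  rw [hrange, ← Set.image_univ, Set.ncard_image_of_injective _ hinj, Set.ncard_univ,
    Nat.card_eq_fintype_card, Fintype.card_sigma]
  simp [hcard, ZMod.card]

/-- The linear form `(x, y) ↦ aᵢ x + bⱼ yᵢ` defining a constraint of the wedge product. -/
def wedgeForm {p q m n : ℕ} (a : ZMod p → Fin m → ℝ) (b : ZMod q → Fin n → ℝ)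
    (e : ZMod p × ZMod q) : (Fin m → ℝ) × (ZMod p → Fin n → ℝ) →ₗ[ℝ] ℝ where
  toFun z := a e.1 ⬝ᵥ z.1 + b e.2 ⬝ᵥ z.2 e.1
  map_add' z z' := by
    simp only [Prod.fst_add, Prod.snd_add, Pi.add_apply, dotProduct_add]
    ring
  map_smul' t z := by
    simp only [Prod.smul_fst, Prod.smul_snd, Pi.smul_apply, dotProduct_smul, smul_eq_mul,
      RingHom.id_apply]
    ring

/-- The vertices of the wedge product `W_{p,q-1} = C_p ⋈ Δ_{q-1}` of a
`p`-gon (facets labeled cyclically by `ZMod p`) and a `(q-1)`-simplex (facets labeled by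
`ZMod q`) correspond exactly to the vectors `(H_0, …, H_{p-1})`, `H_i ⊆ ZMod q`, having
two cyclically adjacent entries equal to `ZMod q` and all other entries complements of
singletons; in particular `W_{p,q-1}` has `p·q^(p-2)` vertices. -/
theorem wedgeProduct_pgon_simplex_vertices
    (p q : ℕ) [NeZero p] [NeZero q] (hp : 3 ≤ p) (hq : 1 ≤ q)
    -- the `p`-gon `C_p`, with facets labeled in cyclic order:
    (a : ZMod p → Fin 2 → ℝ)
    (C : Set (Fin 2 → ℝ)) (hC : C = {x | ∀ i, a i ⬝ᵥ x ≤ 1})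
    (hCbd : Bornology.IsBounded C) (hCdim : setDim C = 2)
    (hCfacets : ∀ i, IsFacetOf {x ∈ C | a i ⬝ᵥ x = 1} C)
    (hCinj : Function.Injective fun i => {x ∈ C | a i ⬝ᵥ x = 1})
    (hCall : ∀ G, IsFacetOf G C → ∃ i, G = {x ∈ C | a i ⬝ᵥ x = 1})
    (hCcyc : ∀ i i' : ZMod p,
      (∃ v, {x ∈ C | a i ⬝ᵥ x = 1} ∩ {x ∈ C | a i' ⬝ᵥ x = 1} = {v}) ↔
        (i' = i + 1 ∨ i = i' + 1))
    -- the `(q-1)`-simplex `Δ_{q-1}`: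
    (b : ZMod q → Fin (q - 1) → ℝ)
    (Δ : Set (Fin (q - 1) → ℝ)) (hΔ : Δ = {y | ∀ j, b j ⬝ᵥ y ≤ 1})
    (hΔbd : Bornology.IsBounded Δ) (hΔdim : setDim Δ = q - 1)
    (hΔfacets : ∀ j, IsFacetOf {y ∈ Δ | b j ⬝ᵥ y = 1} Δ)
    (hΔinj : Function.Injective fun j => {y ∈ Δ | b j ⬝ᵥ y = 1})
    (hΔall : ∀ G, IsFacetOf G Δ → ∃ j, G = {y ∈ Δ | b j ⬝ᵥ y = 1})
    (hΔsimplex : ∀ j : ZMod q, ∃ w, IsVertexOf w Δ ∧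
      {y ∈ Δ | ∀ j', j' ≠ j → b j' ⬝ᵥ y = 1} = {w})
    -- the wedge product `W = C_p ⋈ Δ_{q-1}`:
    (W : Set ((Fin 2 → ℝ) × (ZMod p → Fin (q - 1) → ℝ)))
    (hW : W = {z | ∀ i j, a i ⬝ᵥ z.1 + b j ⬝ᵥ z.2 i ≤ 1}) :
    {H : ZMod p → Set (ZMod q) | ∃ u, IsVertexOf u W ∧
        ∀ i, H i = {j | a i ⬝ᵥ u.1 + b j ⬝ᵥ u.2 i = 1}} =
      {H | ∃ k : ZMod p, H k = Set.univ ∧ H (k + 1) = Set.univ ∧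
        ∀ i, i ≠ k → i ≠ k + 1 → ∃ j : ZMod q, H i = {j}ᶜ} ∧
    {u | IsVertexOf u W}.ncard = p * q ^ (p - 2) := by
  subst hC hΔ
  -- two facets of the polygon sharing a point are adjacent
  have hadj : ∀ x, (∀ i, a i ⬝ᵥ x ≤ 1) → ∀ i i', i ≠ i' → a i ⬝ᵥ x = 1 → a i' ⬝ᵥ x = 1 →
      i' = i + 1 ∨ i = i' + 1 := by
    intro x hx i i' hne hi hi'
    refine (hCcyc i i').mp ⟨x, ?_⟩
    have hdet : a i 0 * a i' 1 - a i 1 * a i' 0 ≠ 0 := fun hdet =>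
      hne (hCinj (by simp only [eq_of_dotProduct_eq_one_of_det_eq_zero hdet hi hi']))
    ext z
    constructor
    · rintro ⟨⟨_, hz⟩, _, hz'⟩
      exact eq_of_dotProduct_eq_of_det_ne_zero hdet (hz.trans hi.symm) (hz'.trans hi'.symm)
    · rintro rfl
      exact ⟨⟨hx, hi⟩, hx, hi'⟩
  have hslack : ∀ x, (∀ i, a i ⬝ᵥ x ≤ 1) → ∀ k, a k ⬝ᵥ x = 1 → a (k + 1) ⬝ᵥ x = 1 →
      ∀ i, i ≠ k → i ≠ k + 1 → a i ⬝ᵥ x < 1 := by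
    intro x hx k hk hk1 i hik hik1
    refine (hx i).lt_of_ne fun hi => ?_
    have e1 : k = i + 1 := (hadj x hx i k hik hi hk).resolve_right hik1
    have e2 : i = k + 1 + 1 := by
      rcases hadj x hx i (k + 1) hik1 hi hk1 with h | h
      · exact absurd (add_right_cancel h).symm hik
      · exact h
    have h3 : ((3 : ℕ) : ZMod p) = 0 := by
      push_cast
      linear_combination -e1 - e2
    obtain rfl : p = 3 := by
      have := Nat.le_of_dvd (by norm_num) ((ZMod.natCast_eq_zero_iff 3 p).mp h3)
      omega
    refine not_forall_dotProduct_eq_one hCbd x fun l => ?_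
    have hl : ∀ k l : ZMod 3, l = k ∨ l = k + 1 ∨ l = k + 1 + 1 := by decide
    rcases hl k l with rfl | rfl | rfl
    exacts [hk, hk1, e2 ▸ hi]
  -- the vertices of the simplex
  have hw : ∀ j, ∃ w, (∀ j', j' ≠ j → b j' ⬝ᵥ w = 1) ∧ b j ⬝ᵥ w < 1 := by
    intro j
    obtain ⟨w, -, hw⟩ := hΔsimplex j
    obtain ⟨hwΔ, hwj⟩ := hw.symm.subset (Set.mem_singleton w)
    refine ⟨w, hwj, (hwΔ j).lt_of_ne fun h => not_forall_dotProduct_eq_one hΔbd w fun j' => ?_⟩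
    by_cases hj : j' = j
    exacts [hj ▸ h, hwj j' hj]
  choose w hw hwlt using hw
  have hker : ∀ (j : ZMod q) d, (∀ j', j' ≠ j → b j' ⬝ᵥ d = 0) → d = 0 := by
    intro j d hd
    have key : ∀ d, (∀ j', j' ≠ j → b j' ⬝ᵥ d = 0) → b j ⬝ᵥ d ≤ 0 → d = 0 := fun d hd hj =>
      eq_zero_of_forall_dotProduct_nonpos hΔbd fun j' => by
        by_cases h : j' = j
        exacts [h ▸ hj, (hd j' h).le]
    rcases le_total (b j ⬝ᵥ d) 0 with h | h
    · exact key d hd h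
    · exact neg_eq_zero.mp (key (-d) (fun j' hj' => by rw [dotProduct_neg, hd j' hj', neg_zero])
        (by rw [dotProduct_neg]; linarith))
  have hW' : W = {z | ∀ e, wedgeForm a b e z ≤ 1} := by
    rw [hW]
    ext z
    exact ⟨fun h e => h e.1 e.2, fun h i j => h (i, j)⟩
  have hWC : ∀ u ∈ W, ∀ i, a i ⬝ᵥ u.1 ≤ 1 := by
    intro u hu i
    rw [hW] at hu
    by_contra! h
    have hz : u.2 i = 0 := eq_zero_of_forall_dotProduct_nonpos hΔbd fun j => by
      linarith [hu i j]
    have := hu i 0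
    rw [hz, dotProduct_zero] at this
    linarith
  have hfull : ∀ u ∈ W, ∀ i, (∀ j, a i ⬝ᵥ u.1 + b j ⬝ᵥ u.2 i = 1) →
      a i ⬝ᵥ u.1 = 1 ∧ u.2 i = 0 := by
    intro u hu i h
    have hz : -u.2 i = 0 := eq_zero_of_forall_dotProduct_nonpos hΔbd fun j => by
      rw [dotProduct_neg]
      linarith [h j, hWC u hu i]
    have hzero := neg_eq_zero.mp hz
    have := h 0
    rw [hzero, dotProduct_zero, add_zero] at this
    exact ⟨this, hzero⟩
  -- a point of the wedge product is determined by its vector, if this has the given form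
  have huniq : ∀ H ∈ wedgeVertexVectors p q, ∀ u ∈ W, ∀ u' ∈ W,
      (∀ i, ∀ j ∈ H i, a i ⬝ᵥ u.1 + b j ⬝ᵥ u.2 i = 1) →
      (∀ i, ∀ j ∈ H i, a i ⬝ᵥ u'.1 + b j ⬝ᵥ u'.2 i = 1) → u = u' := by
    rintro H ⟨k, hk, hk1, hH⟩ u hu u' hu' hT hT'
    obtain ⟨v, hv⟩ := (hCcyc k (k + 1)).mpr (Or.inl rfl)
    have hpt : ∀ u ∈ W, (∀ i, ∀ j ∈ H i, a i ⬝ᵥ u.1 + b j ⬝ᵥ u.2 i = 1) →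
        u.1 = v ∧ u.2 k = 0 ∧ u.2 (k + 1) = 0 := by
      intro u hu hT
      obtain ⟨e, e'⟩ := hfull u hu k fun j => hT k j (hk ▸ Set.mem_univ j)
      obtain ⟨f, f'⟩ := hfull u hu (k + 1) fun j => hT (k + 1) j (hk1 ▸ Set.mem_univ j)
      exact ⟨hv.subset ⟨⟨hWC u hu, e⟩, hWC u hu, f⟩, e', f'⟩
    obtain ⟨hx, hyk, hyk1⟩ := hpt u hu hT
    obtain ⟨hx', hyk', hyk1'⟩ := hpt u' hu' hT'
    refine Prod.ext (hx.trans hx'.symm) (funext fun i => ?_)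
    by_cases hik : i = k
    · rw [hik, hyk, hyk']
    by_cases hik1 : i = k + 1
    · rw [hik1, hyk1, hyk1']
    obtain ⟨j, hj⟩ := hH i hik hik1
    refine sub_eq_zero.mp (hker j _ fun j' hj' => ?_)
    have hmem : j' ∈ H i := hj ▸ hj'
    have e := hT i j' hmem
    have e' := hT' i j' hmem
    rw [hx] at e
    rw [hx'] at e'
    rw [dotProduct_sub]
    linarith
  have hform : ∀ u, IsVertexOf u W →
      (fun i => {j | a i ⬝ᵥ u.1 + b j ⬝ᵥ u.2 i = 1}) ∈ wedgeVertexVectors p q := by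
    intro u hu
    have huW : u ∈ W := hu.1 rfl
    have hdir : ∀ d : (Fin 2 → ℝ) × (ZMod p → Fin (q - 1) → ℝ),
        (∀ i j, a i ⬝ᵥ u.1 + b j ⬝ᵥ u.2 i = 1 → a i ⬝ᵥ d.1 + b j ⬝ᵥ d.2 i = 0) → d = 0 := by
      intro d hd
      rw [hW'] at hu
      exact hu.eq_zero_of_tight fun e he => hd e.1 e.2 he
    have hmiss : ∀ i, ∃ j, ∀ j', j' ≠ j → a i ⬝ᵥ u.1 + b j' ⬝ᵥ u.2 i = 1 := by
      intro i
      by_contra! hcon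
      obtain ⟨j₁, -, h₁⟩ := hcon 0
      obtain ⟨j₂, hne, h₂⟩ := hcon j₁
      have hz := hdir (0, Pi.single i (w j₁ - w j₂)) (by
        intro l j hl
        by_cases hli : l = i
        · subst hli
          have hj₁ : j ≠ j₁ := fun h => h₁ (h ▸ hl)
          have hj₂ : j ≠ j₂ := fun h => h₂ (h ▸ hl)
          simp [dotProduct_sub, hw j₁ j hj₁, hw j₂ j hj₂]
        · simp [hli])
      have hwz : w j₁ - w j₂ = 0 := by simpa using congrFun (congrArg Prod.snd hz) i
      have := hwlt j₂
      rw [← sub_eq_zero.mp hwz, hw j₁ j₂ hne] at this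
      exact lt_irrefl _ this
    choose g hg using hmiss
    have hspan : ∀ d : Fin 2 → ℝ, (∀ i, a i ⬝ᵥ u.1 = 1 → a i ⬝ᵥ d = 0) → d = 0 := by
      intro d hd
      refine congrArg Prod.fst (hdir (d, fun i => -(a i ⬝ᵥ d) • w (g i)) fun i j hij => ?_)
      simp only [dotProduct_smul, smul_eq_mul]
      by_cases hj : j = g i
      · have hall : ∀ j', a i ⬝ᵥ u.1 + b j' ⬝ᵥ u.2 i = 1 := fun j' => by
          by_cases h : j' = g i
          exacts [h.trans hj.symm ▸ hij, hg i j' h]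
        rw [hd i (hfull u huW i hall).1]
        ring
      · rw [hw _ _ hj]
        ring
    obtain ⟨i, hi⟩ : ∃ i, a i ⬝ᵥ u.1 = 1 := by
      by_contra! hcon
      have := congrFun (hspan 1 fun i hi => absurd hi (hcon i)) 0
      simp at this
    obtain ⟨i', hi', hne⟩ : ∃ i', a i' ⬝ᵥ u.1 = 1 ∧ i ≠ i' := by
      by_contra! hcon
      have hz := hspan ![-a i 1, a i 0] fun i' hi' => by
        rw [← hcon i' hi']
        simp only [dotProduct, Fin.sum_univ_two, cons_val_zero, cons_val_one]
        ring
      have hz0 := congrFun hz 0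
      have hz1 := congrFun hz 1
      simp only [cons_val_zero, cons_val_one, Pi.zero_apply, neg_eq_zero] at hz0 hz1
      simp [dotProduct, hz0, hz1] at hi
    obtain ⟨k, hk, hk1⟩ : ∃ k, a k ⬝ᵥ u.1 = 1 ∧ a (k + 1) ⬝ᵥ u.1 = 1 := by
      rcases hadj u.1 (hWC u huW) i i' hne hi hi' with rfl | rfl
      exacts [⟨i, hi, hi'⟩, ⟨i', hi', hi⟩]
    have huniv : ∀ i, a i ⬝ᵥ u.1 = 1 →
        {j | a i ⬝ᵥ u.1 + b j ⬝ᵥ u.2 i = 1} = Set.univ := by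
      intro i hi
      have hz : u.2 i = 0 := hker (g i) _ fun j hj => by linarith [hg i j hj]
      simp [hz, hi]
    refine ⟨k, huniv k hk, huniv (k + 1) hk1, fun i hik hik1 => ⟨g i, ?_⟩⟩
    have hlt := hslack u.1 (hWC u huW) k hk hk1 i hik hik1
    ext j
    refine ⟨fun hj (hjg : j = g i) => hlt.ne (hfull u huW i fun j' => ?_).1, fun hj => hg i j hj⟩
    by_cases h : j' = g i
    exacts [h.trans hjg.symm ▸ hj, hg i j' h]
  have hexists : ∀ H ∈ wedgeVertexVectors p q, ∃ u, IsVertexOf u W ∧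
      ∀ i, H i = {j | a i ⬝ᵥ u.1 + b j ⬝ᵥ u.2 i = 1} := by
    intro H hHmem
    obtain ⟨k, hk, hk1, hH⟩ := id hHmem
    obtain ⟨v, hv⟩ := (hCcyc k (k + 1)).mpr (Or.inl rfl)
    obtain ⟨⟨hvC, hvk⟩, -, hvk1⟩ := hv.symm.subset (Set.mem_singleton v)
    have hlt := hslack v hvC k hvk hvk1
    have hH' : ∀ i, ∃ j, i ≠ k → i ≠ k + 1 → H i = {j}ᶜ := by
      intro i
      by_cases h : i ≠ k ∧ i ≠ k + 1
      · obtain ⟨j, hj⟩ := hH i h.1 h.2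
        exact ⟨j, fun _ _ => hj⟩
      · exact ⟨0, fun h₁ h₂ => absurd ⟨h₁, h₂⟩ h⟩
    choose g hg using hH'
    let u : (Fin 2 → ℝ) × (ZMod p → Fin (q - 1) → ℝ) :=
      (v, fun i => (1 - a i ⬝ᵥ v) • w (g i))
    have hval : ∀ i j, a i ⬝ᵥ u.1 + b j ⬝ᵥ u.2 i =
        a i ⬝ᵥ v + (1 - a i ⬝ᵥ v) * (b j ⬝ᵥ w (g i)) := fun i j => by
      simp [u, dotProduct_smul]
    have hle : ∀ i j, b j ⬝ᵥ w (g i) ≤ 1 := fun i j => by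
      by_cases h : j = g i
      exacts [h ▸ (hwlt (g i)).le, (hw _ _ h).le]
    have huW : u ∈ W := by
      rw [hW]
      intro i j
      rw [hval]
      nlinarith [hle i j, hvC i]
    have htight : ∀ i, H i = {j | a i ⬝ᵥ u.1 + b j ⬝ᵥ u.2 i = 1} := by
      intro i
      ext j
      rw [Set.mem_ofPred_eq, hval]
      by_cases hik : i = k
      · simp [hik, hk, show a k ⬝ᵥ v = 1 from hvk]
      by_cases hik1 : i = k + 1
      · simp [hik1, hk1, show a (k + 1) ⬝ᵥ v = 1 from hvk1]
      rw [hg i hik hik1, Set.mem_compl_iff, Set.mem_singleton_iff]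
      constructor
      · intro hj
        rw [hw _ _ hj]
        ring
      · rintro h rfl
        nlinarith [hlt i hik hik1, hwlt (g i)]
    refine ⟨u, ?_, htight⟩
    have huW' := huW
    rw [hW'] at huW' ⊢
    refine isVertexOf_of_forall_tight_eq huW' fun z hz hzT => ?_
    have hzW : z ∈ W := hW' ▸ hz
    refine huniq H hHmem z hzW u huW (fun i j hj => hzT (i, j) ?_) fun i j hj => ?_
    · rw [htight i] at hj
      exact hj
    · rw [htight i] at hj
      exact hj
  have hset : {H : ZMod p → Set (ZMod q) | ∃ u, IsVertexOf u W ∧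
      ∀ i, H i = {j | a i ⬝ᵥ u.1 + b j ⬝ᵥ u.2 i = 1}} = wedgeVertexVectors p q := by
    ext H
    refine ⟨?_, hexists H⟩
    rintro ⟨u, hu, hH⟩
    rw [show H = _ from funext hH]
    exact hform u hu
  refine ⟨hset, ?_⟩
  rw [← ncard_wedgeVertexVectors (q := q) hp]
  refine Set.ncard_congr (fun u _ i => {j | a i ⬝ᵥ u.1 + b j ⬝ᵥ u.2 i = 1}) hform ?_ ?_
  · intro u u' hu hu' heq
    refine huniq _ (hform u hu) u (hu.1 rfl) u' (hu'.1 rfl) (fun i j hj => hj) fun i j hj => ?_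
    have := congrFun heq i
    exact this.subset hj
  · intro H hH
    obtain ⟨u, hu, hHu⟩ := hexists H hH
    exact ⟨u, hu, (funext hHu).symm⟩
end
end

section
/- For p ≥ 3 and q ≥ 2, the polytopal subcomplex Σ_{p,2q} of the wedge product W_{p,q−1} contains all the vertices of W_{p,q−1}, and it contains exactly the edges encoded by vectors (j̄_0, …, j̄_{k_0−1}, Z_q, j̄_{k_0+1}, …, j̄_{p−1}) (one entry equal to Z_q, all other entries of the form j̄_k = Z_q \ {j_k}). Consequently the f-vector of Σ_{p,2q} is (f_0, f_1, f_2) = (p·q^{p−2}, p·q^{p−1}, 2·q^{p−1}). -/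
open Matrix Set

noncomputable section

/-- The vectors `w j` are the vertices of the simplex `{y | ∀ j, b j ⬝ᵥ y ≤ 1}`, and `lam` are the
coefficients of the positive linear relation between its facet normals. -/
structure IsSimplexFrame {κ : Type*} [Fintype κ] [DecidableEq κ] {n : ℕ}
    (b : κ → Fin n → ℝ) (lam : κ → ℝ) (w : κ → Fin n → ℝ) : Prop where
  pos : ∀ j, 0 < lam j
  sum_eq_one : ∑ j, lam j = 1
  relation : ∀ y, ∑ j, lam j * (b j ⬝ᵥ y) = 0
  dot_of_ne : ∀ j j', j' ≠ j → b j' ⬝ᵥ w j = 1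
  dot_self : ∀ j, b j ⬝ᵥ w j = 1 - (lam j)⁻¹
  eq_zero : ∀ y, (∀ j, b j ⬝ᵥ y = 0) → y = 0

theorem eq_zero_of_isBounded_of_dotProduct_nonpos {κ : Type*} {n : ℕ} {b : κ → Fin n → ℝ}
    (hbd : Bornology.IsBounded {y | ∀ j, b j ⬝ᵥ y ≤ 1}) {d : Fin n → ℝ}
    (hd : ∀ j, b j ⬝ᵥ d ≤ 0) : d = 0 := by
  obtain ⟨R, hR⟩ := hbd.exists_norm_le
  by_contra hne
  have hpos : 0 < ‖d‖ := norm_pos_iff.mpr hne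
  have hR0 : 0 ≤ R := (norm_nonneg 0).trans (hR 0 (by simp))
  have h := hR (((R + 1) / ‖d‖) • d) (fun j => by
    rw [dotProduct_smul, smul_eq_mul]
    have : 0 ≤ (R + 1) / ‖d‖ := by positivity
    nlinarith [hd j])
  rw [norm_smul, Real.norm_of_nonneg (by positivity), div_mul_cancel₀ _ hpos.ne'] at h
  linarith

theorem setDim_eq_zero_of_common_point {κ : Type*} {n : ℕ} {b : κ → Fin n → ℝ}
    (hbd : Bornology.IsBounded {y | ∀ j, b j ⬝ᵥ y ≤ 1}) {v : Fin n → ℝ}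
    (hv : ∀ j, b j ⬝ᵥ v = 1) : setDim {y | ∀ j, b j ⬝ᵥ y ≤ 1} = 0 := by
  have h : {y | ∀ j, b j ⬝ᵥ y ≤ 1} = {v} := by
    ext y
    refine ⟨fun hy => ?_, fun hy => ?_⟩
    · have := eq_zero_of_isBounded_of_dotProduct_nonpos hbd (d := y - v) fun j => by
        rw [dotProduct_sub, hv j]
        linarith [hy j]
      exact sub_eq_zero.mp this
    · rw [hy]
      exact fun j => (hv j).le
  rw [h, setDim, direction_affineSpan, vectorSpan_singleton]
  simp

theorem exists_isSimplexFrame {κ : Type*} [Fintype κ] [DecidableEq κ] {n : ℕ}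
    (hn : 0 < n) (hcard : n < Fintype.card κ) (b : κ → Fin n → ℝ)
    (hbd : Bornology.IsBounded {y | ∀ j, b j ⬝ᵥ y ≤ 1})
    (hdim : setDim {y | ∀ j, b j ⬝ᵥ y ≤ 1} = n) (w : κ → Fin n → ℝ)
    (hw : ∀ j j', j' ≠ j → b j' ⬝ᵥ w j = 1) (hwle : ∀ j, b j ⬝ᵥ w j ≤ 1) :
    ∃ lam, IsSimplexFrame b lam w := by
  have hlt : ∀ j, 0 < 1 - b j ⬝ᵥ w j := fun j => by
    refine sub_pos.mpr ((hwle j).lt_of_ne fun h => ?_)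
    have := setDim_eq_zero_of_common_point hbd (v := w j) fun j' => by
      by_cases hj : j' = j
      · rw [hj, h]
      · exact hw j j' hj
    omega
  obtain ⟨μ, hμ, j₀, hj₀⟩ : ∃ μ : κ → ℝ, ∑ j, μ j • b j = 0 ∧ ∃ j, μ j ≠ 0 := by
    have : ¬ LinearIndependent ℝ b := fun h => by
      have := h.fintype_card_le_finrank
      simp at this
      omega
    simpa [Fintype.linearIndependent_iff] using this
  have hrel : ∀ y, ∑ j, μ j * (b j ⬝ᵥ y) = 0 := fun y => by
    have := congrArg (· ⬝ᵥ y) hμ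
    simpa [sum_dotProduct] using this
  have hM : ∀ j, μ j * (1 - b j ⬝ᵥ w j) = ∑ j, μ j := fun j => by
    have h1 : ∑ i, (μ i - μ i * (b i ⬝ᵥ w j)) = μ j - μ j * (b j ⬝ᵥ w j) :=
      Fintype.sum_eq_single j fun i hi => by rw [hw j i hi]; ring
    rw [Finset.sum_sub_distrib, hrel] at h1
    linarith
  have hM0 : ∑ j, μ j ≠ 0 := fun h => by
    have := hM j₀
    rw [h, mul_eq_zero] at this
    exact this.elim hj₀ (hlt j₀).ne'
  have hform : ∀ j, μ j / ∑ j, μ j = (1 - b j ⬝ᵥ w j)⁻¹ := fun j => by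
    rw [div_eq_iff hM0, ← hM j]
    field_simp [(hlt j).ne']
  refine ⟨fun j => μ j / ∑ j, μ j, fun j => ?_, ?_, fun y => ?_, hw, fun j => ?_, fun y hy => ?_⟩
  · simp only [hform]
    exact inv_pos.mpr (hlt j)
  · rw [← Finset.sum_div, div_self hM0]
  · simp only [div_mul_eq_mul_div]
    rw [← Finset.sum_div, hrel, zero_div]
  · simp only [hform]
    rw [inv_inv]
    ring
  · exact eq_zero_of_isBounded_of_dotProduct_nonpos hbd fun j => (hy j).le

namespace IsSimplexFrame

variable {κ : Type*} [Fintype κ] [DecidableEq κ] {n : ℕ} {b : κ → Fin n → ℝ} {lam : κ → ℝ}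
  {w : κ → Fin n → ℝ}

theorem sum_mul_add (h : IsSimplexFrame b lam w) (t : ℝ) (y : Fin n → ℝ) :
    ∑ j, lam j * (t + b j ⬝ᵥ y) = t := by
  simp only [mul_add]
  rw [Finset.sum_add_distrib, h.relation, ← Finset.sum_mul, h.sum_eq_one]
  ring

theorem le_one (h : IsSimplexFrame b lam w) {t : ℝ} {y : Fin n → ℝ}
    (hy : ∀ j, t + b j ⬝ᵥ y ≤ 1) : t ≤ 1 := by
  rw [← h.sum_mul_add t y, ← h.sum_eq_one]
  exact Finset.sum_le_sum fun j _ => mul_le_of_le_one_right (h.pos j).le (hy j)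

theorem eq_one (h : IsSimplexFrame b lam w) {t : ℝ} {y : Fin n → ℝ}
    (hy : ∀ j, t + b j ⬝ᵥ y = 1) : t = 1 := by
  rw [← h.sum_mul_add t y, ← h.sum_eq_one]
  exact Finset.sum_congr rfl fun j _ => by rw [hy j, mul_one]

theorem dot_le_one (h : IsSimplexFrame b lam w) (j j' : κ) : b j' ⬝ᵥ w j ≤ 1 := by
  by_cases hj : j' = j
  · rw [hj, h.dot_self]
    linarith [inv_pos.mpr (h.pos j)]
  · exact (h.dot_of_ne j j' hj).le

theorem injective (h : IsSimplexFrame b lam w) : Function.Injective w := fun j j' hjj => by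
  by_contra hne
  have h1 := h.dot_self j
  rw [hjj, h.dot_of_ne j' j hne] at h1
  linarith [inv_pos.mpr (h.pos j)]

theorem eq_smul (h : IsSimplexFrame b lam w) {t : ℝ} {y : Fin n → ℝ} {j : κ}
    (hy : ∀ j', j' ≠ j → t + b j' ⬝ᵥ y = 1) : y = (1 - t) • w j := by
  have h1 : ∀ j', j' ≠ j → b j' ⬝ᵥ (y - (1 - t) • w j) = 0 := fun j' hj => by
    rw [dotProduct_sub, dotProduct_smul, h.dot_of_ne j j' hj, smul_eq_mul]
    linarith [hy j' hj]
  refine sub_eq_zero.mp (h.eq_zero _ fun j' => ?_)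
  by_cases hj : j' = j
  · have h2 := h.relation (y - (1 - t) • w j)
    rw [Fintype.sum_eq_single j fun i hi => by rw [h1 i hi, mul_zero]] at h2
    rw [hj]
    exact (mul_eq_zero.mp h2).resolve_left (h.pos j).ne'
  · exact h1 j' hj

/-- A point of the simplex scaled by `1 - t` is a nonnegative combination of the vertices. -/
theorem eq_sum (h : IsSimplexFrame b lam w) (t : ℝ) (y : Fin n → ℝ) :
    y = ∑ j, (lam j * (1 - (t + b j ⬝ᵥ y))) • w j := by
  refine sub_eq_zero.mp (h.eq_zero _ fun j' => ?_)
  have hsum : ∑ j, lam j * (1 - (t + b j ⬝ᵥ y)) = 1 - t := by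
    simp only [mul_sub, mul_one]
    rw [Finset.sum_sub_distrib, h.sum_eq_one, h.sum_mul_add]
  have h1 : ∑ j, (lam j * (1 - (t + b j ⬝ᵥ y)) - lam j * (1 - (t + b j ⬝ᵥ y)) * (b j' ⬝ᵥ w j))
      = 1 - (t + b j' ⬝ᵥ y) := by
    rw [Fintype.sum_eq_single j' fun i hi => by rw [h.dot_of_ne i j' hi.symm]; ring, h.dot_self]
    field_simp [(h.pos j').ne']
    ring
  rw [Finset.sum_sub_distrib, hsum] at h1
  simp only [dotProduct_sub, dotProduct_sum, dotProduct_smul, smul_eq_mul]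
  linarith

theorem exists_le_vertex (h : IsSimplexFrame b lam w) [Nonempty κ] {t : ℝ} {y : Fin n → ℝ}
    (hy : ∀ j, t + b j ⬝ᵥ y ≤ 1) (c : (Fin n → ℝ) →ₗ[ℝ] ℝ) :
    ∃ j, c y ≤ c ((1 - t) • w j) := by
  obtain ⟨j, hj⟩ := Finite.exists_max fun j => c (w j)
  refine ⟨j, ?_⟩
  conv_lhs => rw [h.eq_sum t y]
  rw [map_sum, map_smul]
  have hsum : ∑ j, lam j * (1 - (t + b j ⬝ᵥ y)) = 1 - t := by
    simp only [mul_sub, mul_one]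
    rw [Finset.sum_sub_distrib, h.sum_eq_one, h.sum_mul_add]
  rw [← hsum, Finset.sum_smul]
  refine Finset.sum_le_sum fun i _ => ?_
  rw [map_smul]
  exact mul_le_mul_of_nonneg_left (hj i)
    (mul_nonneg (h.pos i).le (sub_nonneg.mpr (hy i)))

end IsSimplexFrame

theorem isFaceOf_tight {σ V : Type*} [Finite σ] [AddCommGroup V] [Module ℝ V]
    (ℓ : σ → V →ₗ[ℝ] ℝ) (T : Set σ) :
    IsFaceOf {x ∈ {x | ∀ s, ℓ s x ≤ 1} | ∀ s ∈ T, ℓ s x = 1} {x | ∀ s, ℓ s x ≤ 1} := by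
  refine ⟨sep_subset _ _, ∑ s ∈ T.toFinite.toFinset, ℓ s, ∑ s ∈ T.toFinite.toFinset, 1,
    fun x hx => ?_, ?_⟩
  · rw [LinearMap.sum_apply]
    exact Finset.sum_le_sum fun s _ => hx s
  · ext x
    refine and_congr_right fun hx => ?_
    rw [LinearMap.sum_apply, Finset.sum_eq_sum_iff_of_le fun s _ => hx s]
    simp

theorem setDim_image {V V' : Type*} [AddCommGroup V] [Module ℝ V] [AddCommGroup V'] [Module ℝ V']
    (f : V →ᵃ[ℝ] V') (hf : Function.Injective f) (s : Set V) : setDim (f '' s) = setDim s := by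
  rw [setDim, setDim, ← AffineSubspace.map_span, AffineSubspace.map_direction]
  exact (Submodule.equivMapOfInjective f.linear
    (f.linear_injective_iff.mpr hf) _).finrank_eq.symm

theorem IsFaceOf.inter_preimage {V V' : Type*} [AddCommGroup V] [Module ℝ V] [AddCommGroup V']
    [Module ℝ V'] (f : V →ᵃ[ℝ] V') {C : Set V} {P e : Set V'} (he : IsFaceOf e P)
    (hC : MapsTo f C P) : IsFaceOf (C ∩ f ⁻¹' e) C := by
  obtain ⟨-, c, β, hle, rfl⟩ := he
  have hf : ∀ x, c (f x) = (c ∘ₗ f.linear) x + c (f 0) := fun x => by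
    have := congrFun (AffineMap.decomp f) x
    simp only [Pi.add_apply] at this
    rw [this, map_add]
    rfl
  refine ⟨inter_subset_left, c ∘ₗ f.linear, β - c (f 0), fun x hx => ?_, ?_⟩
  · have := hle _ (hC hx)
    rw [hf] at this
    linarith
  · ext x
    refine and_congr_right fun hx => ?_
    simp only [mem_preimage, mem_ofPred_eq, hC hx, true_and]
    rw [hf]
    exact ⟨fun h => by linarith, fun h => by linarith⟩

theorem ncard_sum_eq {ι A : Type*} [Fintype ι] [Fintype A] [DecidableEq ι] [AddCommGroup A]
    (i₀ : ι) (c : A) :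
    {f : ι → A | ∑ i, f i = c}.ncard = Fintype.card A ^ (Fintype.card ι - 1) := by
  have hrange : {f : ι → A | ∑ i, f i = c} = range fun g : {i // i ≠ i₀} → A =>
      (Equiv.funSplitAt i₀ A).symm (c - ∑ i, g i, g) := by
    ext f
    simp only [mem_ofPred_eq, mem_range, Equiv.symm_apply_eq]
    constructor
    · rintro rfl
      refine ⟨fun i => f i, ?_⟩
      rw [Fintype.sum_eq_add_sum_subtype_ne f i₀, add_sub_cancel_right]
      rfl
    · rintro ⟨g, hg⟩
      obtain ⟨h1, h2⟩ := Prod.mk.injEq .. ▸ hg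
      rw [Fintype.sum_eq_add_sum_subtype_ne f i₀]
      subst h2
      exact (sub_eq_iff_eq_add.mp h1).symm
  rw [hrange, ncard_range_of_injective fun g g' h =>
    (Prod.mk.inj ((Equiv.funSplitAt i₀ A).symm.injective h)).2]
  simp

theorem ncard_labelled {ι κ α : Type*} [Fintype ι] [DecidableEq ι] [Fintype κ] [Nonempty κ]
    (S : ι → Finset ι) {r : ℕ} (hS : ∀ k, (S k).card = r) (Φ : ι → (ι → κ) → α)
    (hΦ : ∀ k k' j j', Φ k j = Φ k' j' ↔ k = k' ∧ ∀ i ∉ S k, j i = j' i) :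
    {e | ∃ k j, e = Φ k j}.ncard = Fintype.card ι * Fintype.card κ ^ (Fintype.card ι - r) := by
  obtain ⟨z⟩ := ‹Nonempty κ›
  have hrange : {e | ∃ k j, e = Φ k j} = range fun x : (k : ι) × ({i // i ∉ S k} → κ) =>
      Φ x.1 fun i => if h : i ∉ S x.1 then x.2 ⟨i, h⟩ else z := by
    ext e
    constructor
    · rintro ⟨k, j, rfl⟩
      refine ⟨⟨k, fun i => j i⟩, (hΦ ..).mpr ⟨rfl, fun i hi => ?_⟩⟩
      simp only at hi
      simp [hi]
    · rintro ⟨x, rfl⟩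
      exact ⟨_, _, rfl⟩
  rw [hrange, ncard_range_of_injective]
  · rw [Nat.card_eq_fintype_card, Fintype.card_sigma]
    simp [Fintype.card_subtype_compl, hS]
  · rintro ⟨k, g⟩ ⟨k', g'⟩ h
    obtain ⟨h1, h2⟩ := (hΦ ..).mp h
    simp only at h1
    subst h1
    congr 1
    funext i
    simpa [i.2] using h2 i i.2

section Polygon

variable {p : ℕ} {a : ZMod p → Fin 2 → ℝ}

theorem exists_two_tight_of_isVertexOf [NeZero p] {x : Fin 2 → ℝ}
    (hx : IsVertexOf x {x | ∀ i, a i ⬝ᵥ x ≤ 1}) :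
    ∃ i i', i ≠ i' ∧ a i ⬝ᵥ x = 1 ∧ a i' ⬝ᵥ x = 1 := by
  by_contra! hcon
  obtain ⟨i, hi⟩ : ∃ i, ∀ j, a j ⬝ᵥ x = 1 → j = i := by
    by_cases h : ∃ i, a i ⬝ᵥ x = 1
    · obtain ⟨i, hi⟩ := h
      exact ⟨i, fun j hj => by_contra fun hne => hcon j i hne hj hi⟩
    · exact ⟨0, fun j hj => (h ⟨j, hj⟩).elim⟩
  obtain ⟨d, hd0, hd⟩ : ∃ d : Fin 2 → ℝ, d ≠ 0 ∧ a i ⬝ᵥ d = 0 := by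
    by_cases h : a i = 0
    · exact ⟨1, one_ne_zero, by simp [h]⟩
    · refine ⟨![-(a i 1), a i 0], fun h0 => h ?_, by simp [dotProduct, Fin.sum_univ_two]; ring⟩
      have h1 := congrFun h0 0
      have h2 := congrFun h0 1
      simp at h1 h2
      ext k
      fin_cases k <;> simp [h1, h2]
  obtain ⟨hsub, c, β, hle, heq⟩ := hx
  have hxC : ∀ i, a i ⬝ᵥ x ≤ 1 := hsub rfl
  have hcx : c x = β := by
    have : x ∈ ({x} : Set (Fin 2 → ℝ)) := rfl
    rw [heq] at this
    exact this.2
  have hev : ∀ᶠ ε : ℝ in nhds 0, ∀ j, a j ⬝ᵥ (x + ε • d) ≤ 1 := by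
    refine Filter.eventually_all.mpr fun j => ?_
    by_cases hj : a j ⬝ᵥ x = 1
    · have hji := hi j hj
      rw [hji] at hj ⊢
      simp [dotProduct_add, dotProduct_smul, hd, hj]
    · have hlt : a j ⬝ᵥ x < 1 := (hxC j).lt_of_ne hj
      have hcont : Continuous fun ε : ℝ => a j ⬝ᵥ x + ε * (a j ⬝ᵥ d) := by fun_prop
      have := hcont.continuousAt.eventually_lt (x₀ := 0) (g := fun _ => (1 : ℝ))
        continuousAt_const (by simpa only [zero_mul, add_zero] using hlt)
      filter_upwards [this] with ε hε
      rw [dotProduct_add, dotProduct_smul, smul_eq_mul]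
      exact hε.le
  obtain ⟨δ, hδ, hball⟩ := Metric.eventually_nhds_iff.mp hev
  have h1 := hball (y := δ / 2) (by rw [Real.dist_eq, sub_zero, abs_of_pos] <;> linarith)
  have h2 := hball (y := -(δ / 2)) (by
    rw [Real.dist_eq, sub_zero, abs_neg, abs_of_pos] <;> linarith)
  have h3 := hle _ h1
  have h4 := hle _ h2
  simp only [map_add, map_smul, smul_eq_mul, hcx] at h3 h4
  have hmem : x + (δ / 2) • d ∈ ({x} : Set (Fin 2 → ℝ)) := by
    rw [heq]
    refine ⟨h1, ?_⟩
    simp only [map_add, map_smul, smul_eq_mul, hcx]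
    linarith
  have : (δ / 2) • d = 0 := by simpa using hmem
  exact (smul_eq_zero.mp this).elim (half_pos hδ).ne' hd0

/-- Two different lines in the plane share at most one point. -/
theorem eq_of_dotProduct_eq_one {u v x y : Fin 2 → ℝ} (huv : u ≠ v) (hux : u ⬝ᵥ x = 1)
    (hvx : v ⬝ᵥ x = 1) (huy : u ⬝ᵥ y = 1) (hvy : v ⬝ᵥ y = 1) : y = x := by
  simp only [dotProduct, Fin.sum_univ_two] at hux hvx huy hvy
  by_cases hD : x 0 * y 1 - x 1 * y 0 = 0
  · ext k
    fin_cases k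
    · show y 0 = x 0
      linear_combination (-y 0) * hux + x 0 * huy + (-u 1) * hD
    · show y 1 = x 1
      linear_combination (-y 1) * hux + x 1 * huy + u 0 * hD
  · refine (huv ?_).elim
    ext k
    fin_cases k
    · show u 0 = v 0
      refine mul_right_cancel₀ hD ?_
      linear_combination (hux - hvx) * y 1 - (huy - hvy) * x 1
    · show u 1 = v 1
      refine mul_right_cancel₀ hD ?_
      linear_combination (huy - hvy) * x 0 - (hux - hvx) * y 0

theorem adjacent_of_tight (hinj : Function.Injective a)
    (hcyc : ∀ i i' : ZMod p,
      (∃ v, {x ∈ {x | ∀ i, a i ⬝ᵥ x ≤ 1} | a i ⬝ᵥ x = 1} ∩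
        {x ∈ {x | ∀ i, a i ⬝ᵥ x ≤ 1} | a i' ⬝ᵥ x = 1} = {v}) ↔ (i' = i + 1 ∨ i = i' + 1))
    {x : Fin 2 → ℝ} (hx : ∀ i, a i ⬝ᵥ x ≤ 1) {i i' : ZMod p} (hne : i ≠ i')
    (hi : a i ⬝ᵥ x = 1) (hi' : a i' ⬝ᵥ x = 1) : i' = i + 1 ∨ i = i' + 1 := by
  refine (hcyc i i').mp ⟨x, eq_singleton_iff_unique_mem.mpr ⟨⟨⟨hx, hi⟩, hx, hi'⟩, ?_⟩⟩
  rintro y ⟨⟨-, hy⟩, -, hy'⟩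
  exact eq_of_dotProduct_eq_one (hinj.ne hne) hi hi' hy hy'

theorem exists_polygon_vertices (hp : 3 ≤ p) (hinj : Function.Injective a)
    (hbd : Bornology.IsBounded {x | ∀ i, a i ⬝ᵥ x ≤ 1})
    (hdim : setDim {x | ∀ i, a i ⬝ᵥ x ≤ 1} = 2)
    (hcyc : ∀ i i' : ZMod p,
      (∃ v, {x ∈ {x | ∀ i, a i ⬝ᵥ x ≤ 1} | a i ⬝ᵥ x = 1} ∩
        {x ∈ {x | ∀ i, a i ⬝ᵥ x ≤ 1} | a i' ⬝ᵥ x = 1} = {v}) ↔ (i' = i + 1 ∨ i = i' + 1)) :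
    ∃ v : ZMod p → Fin 2 → ℝ, (∀ k i, a i ⬝ᵥ v k ≤ 1) ∧
      (∀ k i, a i ⬝ᵥ v k = 1 ↔ i = k ∨ i = k + 1) ∧
      ∀ k x, a k ⬝ᵥ x = 1 → a (k + 1) ⬝ᵥ x = 1 → x = v k := by
  have h1p : (1 : ZMod p) ≠ 0 := by
    have : Fact (1 < p) := ⟨by omega⟩
    exact one_ne_zero
  choose v hv using fun k => (hcyc k (k + 1)).mpr (Or.inl rfl)
  have hmem : ∀ k, (∀ i, a i ⬝ᵥ v k ≤ 1) ∧ a k ⬝ᵥ v k = 1 ∧ a (k + 1) ⬝ᵥ v k = 1 := fun k => by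
    have : v k ∈ ({v k} : Set (Fin 2 → ℝ)) := rfl
    rw [← hv k] at this
    exact ⟨this.1.1, this.1.2, this.2.2⟩
  have hkk : ∀ k : ZMod p, k ≠ k + 1 := fun k h => h1p (by simpa using h)
  refine ⟨v, fun k => (hmem k).1, fun k i => ⟨fun hi => ?_, ?_⟩, fun k x h h' =>
    eq_of_dotProduct_eq_one (hinj.ne (hkk k)) (hmem k).2.1 (hmem k).2.2 h h'⟩
  · by_contra! hne
    have had := fun i j : ZMod p => adjacent_of_tight hinj hcyc (hmem k).1 (i := i) (i' := j)
    have hik : k = i + 1 := (had i k hne.1 hi (hmem k).2.1).resolve_right hne.2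
    have hik' : i = k + 1 + 1 := (had i (k + 1) hne.2 hi (hmem k).2.2).resolve_left fun h =>
      hne.1 (add_right_cancel h).symm
    have h3 : ((3 : ℕ) : ZMod p) = 0 := by
      push_cast
      linear_combination -hik - hik'
    have hp3 : p = 3 :=
      le_antisymm (Nat.le_of_dvd (by norm_num) ((ZMod.natCast_eq_zero_iff 3 p).mp h3)) hp
    subst hp3
    have hall : ∀ m, a m ⬝ᵥ v k = 1 := fun m => by
      have hcases : ∀ k m : ZMod 3, m = k ∨ m = k + 1 ∨ m = k + 1 + 1 := by decide
      rcases hcases k m with h | h | h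
      · rw [h, (hmem k).2.1]
      · rw [h, (hmem k).2.2]
      · rw [h, ← hik', hi]
    have := setDim_eq_zero_of_common_point hbd hall
    omega
  · rintro (rfl | rfl)
    exacts [(hmem _).2.1, (hmem k).2.2]

end Polygon

section WedgeProduct

variable {ι κ : Type*} {m n : ℕ}

def wedgeFunctional (a : ι → Fin m → ℝ) (b : κ → Fin n → ℝ) (s : ι × κ) :
    (Fin m → ℝ) × (ι → Fin n → ℝ) →ₗ[ℝ] ℝ :=
  dotProductBilin ℝ ℝ (a s.1) ∘ₗ LinearMap.fst ℝ _ _ +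
    dotProductBilin ℝ ℝ (b s.2) ∘ₗ LinearMap.proj s.1 ∘ₗ LinearMap.snd ℝ _ _

theorem wedgeFunctional_apply (a : ι → Fin m → ℝ) (b : κ → Fin n → ℝ) (s : ι × κ)
    (z : (Fin m → ℝ) × (ι → Fin n → ℝ)) :
    wedgeFunctional a b s z = a s.1 ⬝ᵥ z.1 + b s.2 ⬝ᵥ z.2 s.1 := rfl

/-- The affine embedding of the base onto the face of the wedge product encoded by the
complements of the labels `jv i`. -/
def wedgeLift (a : ι → Fin m → ℝ) (w : κ → Fin n → ℝ) (jv : ι → κ) :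
    (Fin m → ℝ) →ᵃ[ℝ] (Fin m → ℝ) × (ι → Fin n → ℝ) where
  toFun x := (x, fun i => (1 - a i ⬝ᵥ x) • w (jv i))
  linear := LinearMap.prod LinearMap.id
    (LinearMap.pi fun i => (-dotProductBilin ℝ ℝ (a i)).smulRight (w (jv i)))
  map_vadd' x d := by
    ext i
    · simp
    · simp [dotProduct_add]
      ring

theorem wedgeLift_apply (a : ι → Fin m → ℝ) (w : κ → Fin n → ℝ) (jv : ι → κ) (x : Fin m → ℝ) :
    wedgeLift a w jv x = (x, fun i => (1 - a i ⬝ᵥ x) • w (jv i)) := rfl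

theorem wedgeLift_tight_of_eq {a : ι → Fin m → ℝ} {b : κ → Fin n → ℝ}
    {w : κ → Fin n → ℝ} {jv : ι → κ} {x : Fin m → ℝ} {i : ι}
    (hi : a i ⬝ᵥ x = 1) (j : κ) :
    a i ⬝ᵥ (wedgeLift a w jv x).1 + b j ⬝ᵥ (wedgeLift a w jv x).2 i = 1 := by
  simp [wedgeLift_apply, hi]

theorem wedgeLift_injective (a : ι → Fin m → ℝ) (w : κ → Fin n → ℝ) (jv : ι → κ) :
    Function.Injective (wedgeLift a w jv) :=
  fun _ _ h => congrArg Prod.fst h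

theorem isFaceOf_wedge [Finite ι] [Finite κ] (a : ι → Fin m → ℝ) (b : κ → Fin n → ℝ)
    (T : Set (ι × κ)) :
    IsFaceOf {z ∈ {z : (Fin m → ℝ) × (ι → Fin n → ℝ) | ∀ i j, a i ⬝ᵥ z.1 + b j ⬝ᵥ z.2 i ≤ 1} |
        ∀ s ∈ T, a s.1 ⬝ᵥ z.1 + b s.2 ⬝ᵥ z.2 s.1 = 1}
      {z : (Fin m → ℝ) × (ι → Fin n → ℝ) | ∀ i j, a i ⬝ᵥ z.1 + b j ⬝ᵥ z.2 i ≤ 1} := by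
  simpa only [wedgeFunctional_apply, Prod.forall] using isFaceOf_tight (wedgeFunctional a b) T

namespace IsSimplexFrame

variable [Fintype κ] [DecidableEq κ] {a : ι → Fin m → ℝ} {b : κ → Fin n → ℝ} {lam : κ → ℝ}
  {w : κ → Fin n → ℝ}

theorem wedgeLift_eq_iff (h : IsSimplexFrame b lam w) {jv jv' : ι → κ} {x x' : Fin m → ℝ} :
    wedgeLift a w jv x = wedgeLift a w jv' x' ↔ x = x' ∧ ∀ i, a i ⬝ᵥ x ≠ 1 → jv i = jv' i := by
  rw [wedgeLift_apply, wedgeLift_apply, Prod.mk.injEq]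
  refine and_congr_right fun hx => ?_
  subst hx
  rw [funext_iff]
  refine forall_congr' fun i => ?_
  by_cases hi : a i ⬝ᵥ x = 1
  · simp [hi]
  · have : 1 - a i ⬝ᵥ x ≠ 0 := fun h0 => hi (sub_eq_zero.mp h0).symm
    simp [hi, this, h.injective.eq_iff]

theorem wedgeLift_mem (h : IsSimplexFrame b lam w) {jv : ι → κ} {x : Fin m → ℝ}
    (hx : ∀ i, a i ⬝ᵥ x ≤ 1) (i : ι) (j : κ) :
    a i ⬝ᵥ (wedgeLift a w jv x).1 + b j ⬝ᵥ (wedgeLift a w jv x).2 i ≤ 1 := by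
  rw [wedgeLift_apply, dotProduct_smul, smul_eq_mul]
  nlinarith [hx i, h.dot_le_one (jv i) j]

theorem wedgeLift_tight (h : IsSimplexFrame b lam w) {jv : ι → κ} {x : Fin m → ℝ} {i : ι} {j : κ}
    (hj : j ≠ jv i) :
    a i ⬝ᵥ (wedgeLift a w jv x).1 + b j ⬝ᵥ (wedgeLift a w jv x).2 i = 1 := by
  rw [wedgeLift_apply, dotProduct_smul, smul_eq_mul, h.dot_of_ne _ _ hj]
  ring

theorem eq_wedgeLift (h : IsSimplexFrame b lam w) {jv : ι → κ}
    {z : (Fin m → ℝ) × (ι → Fin n → ℝ)}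
    (hz : ∀ i, ∀ j, j ≠ jv i → a i ⬝ᵥ z.1 + b j ⬝ᵥ z.2 i = 1) : z = wedgeLift a w jv z.1 :=
  Prod.ext rfl (funext fun i => h.eq_smul (hz i))

theorem image_wedgeLift (h : IsSimplexFrame b lam w) (jv : ι → κ) :
    {z ∈ {z : (Fin m → ℝ) × (ι → Fin n → ℝ) | ∀ i j, a i ⬝ᵥ z.1 + b j ⬝ᵥ z.2 i ≤ 1} |
      ∀ i, ∀ j, j ≠ jv i → a i ⬝ᵥ z.1 + b j ⬝ᵥ z.2 i = 1} =
    wedgeLift a w jv '' {x | ∀ i, a i ⬝ᵥ x ≤ 1} := by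
  ext z
  constructor
  · rintro ⟨hz, hz'⟩
    exact ⟨z.1, fun i => h.le_one (hz i), (h.eq_wedgeLift hz').symm⟩
  · rintro ⟨x, hx, rfl⟩
    exact ⟨h.wedgeLift_mem hx, fun i j hj => h.wedgeLift_tight hj⟩

theorem image_wedgeLift_tight (h : IsSimplexFrame b lam w) (jv : ι → κ) (k : ι) :
    {z ∈ {z : (Fin m → ℝ) × (ι → Fin n → ℝ) | ∀ i j, a i ⬝ᵥ z.1 + b j ⬝ᵥ z.2 i ≤ 1} |
      (∀ j, a k ⬝ᵥ z.1 + b j ⬝ᵥ z.2 k = 1) ∧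
        ∀ i, i ≠ k → ∀ j, j ≠ jv i → a i ⬝ᵥ z.1 + b j ⬝ᵥ z.2 i = 1} =
    wedgeLift a w jv '' {x ∈ {x | ∀ i, a i ⬝ᵥ x ≤ 1} | a k ⬝ᵥ x = 1} := by
  ext z
  constructor
  · rintro ⟨hz, hzk, hz'⟩
    refine ⟨z.1, ⟨fun i => h.le_one (hz i), h.eq_one hzk⟩, (h.eq_wedgeLift fun i j hj => ?_).symm⟩
    by_cases hik : i = k
    · rw [hik, hzk]
    · exact hz' i hik j hj
  · rintro ⟨x, ⟨hx, hxk⟩, rfl⟩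
    exact ⟨h.wedgeLift_mem hx, wedgeLift_tight_of_eq hxk, fun i _ j hj => h.wedgeLift_tight hj⟩

theorem isVertexOf_wedgeLift [Finite ι] (h : IsSimplexFrame b lam w) (jv : ι → κ) {x : Fin m → ℝ}
    (hx : ∀ i, a i ⬝ᵥ x ≤ 1) (huniq : ∀ y, (∀ i, a i ⬝ᵥ x = 1 → a i ⬝ᵥ y = 1) → y = x) :
    IsVertexOf (wedgeLift a w jv x)
      {z : (Fin m → ℝ) × (ι → Fin n → ℝ) | ∀ i j, a i ⬝ᵥ z.1 + b j ⬝ᵥ z.2 i ≤ 1} := by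
  have hface := isFaceOf_wedge a b {s : ι × κ | a s.1 ⬝ᵥ x = 1 ∨ s.2 ≠ jv s.1}
  unfold IsVertexOf
  convert hface using 1
  ext z
  constructor
  · rintro rfl
    refine ⟨h.wedgeLift_mem hx, fun s hs => ?_⟩
    rcases hs with hs | hs
    · exact wedgeLift_tight_of_eq hs _
    · exact h.wedgeLift_tight hs
  · rintro ⟨-, hz'⟩
    have hzx : z.1 = x := huniq _ fun i hi => h.eq_one (y := z.2 i) fun j =>
      hz' (i, j) (Or.inl hi)
    rw [h.eq_wedgeLift fun i j hj => hz' (i, j) (Or.inr hj), hzx]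
    rfl

/-- Every vertex of the wedge product lies on some lift of the base. -/
theorem exists_eq_wedgeLift [Fintype ι] [DecidableEq ι] [Nonempty κ] (h : IsSimplexFrame b lam w)
    {z : (Fin m → ℝ) × (ι → Fin n → ℝ)}
    (hz : IsVertexOf z
      {z : (Fin m → ℝ) × (ι → Fin n → ℝ) | ∀ i j, a i ⬝ᵥ z.1 + b j ⬝ᵥ z.2 i ≤ 1}) :
    ∃ jv, z = wedgeLift a w jv z.1 := by
  obtain ⟨hsub, c, β, hle, heq⟩ := hz
  have hzW := hsub (mem_singleton z)
  have hcz : c z = β := (heq ▸ mem_singleton z :).2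
  choose jv hjv using fun i => h.exists_le_vertex (hzW i)
    (c ∘ₗ LinearMap.inr ℝ _ _ ∘ₗ LinearMap.single ℝ (fun _ => Fin n → ℝ) i)
  have hdecomp : ∀ y : (Fin m → ℝ) × (ι → Fin n → ℝ), c y = c (y.1, 0) +
      ∑ i, (c ∘ₗ LinearMap.inr ℝ _ _ ∘ₗ LinearMap.single ℝ (fun _ => Fin n → ℝ) i) (y.2 i) :=
    fun y => by
      simp only [LinearMap.comp_apply, ← map_sum, LinearMap.coe_single, Finset.univ_sum_single]
      rw [← map_add]
      simp
  have hmem : wedgeLift a w jv z.1 ∈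
      {z : (Fin m → ℝ) × (ι → Fin n → ℝ) | ∀ i j, a i ⬝ᵥ z.1 + b j ⬝ᵥ z.2 i ≤ 1} :=
    h.wedgeLift_mem fun i => h.le_one (hzW i)
  have hge : c z ≤ c (wedgeLift a w jv z.1) := by
    rw [hdecomp z, hdecomp (wedgeLift a w jv z.1)]
    exact add_le_add le_rfl (Finset.sum_le_sum fun i _ => hjv i)
  have : wedgeLift a w jv z.1 ∈ ({z} : Set _) := by
    rw [heq]
    exact ⟨hmem, le_antisymm (hle _ hmem) (hcz ▸ hge)⟩
  exact ⟨jv, this.symm⟩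

theorem isVertexOf_of_wedgeLift (h : IsSimplexFrame b lam w) {jv : ι → κ} {x : Fin m → ℝ}
    (hx : ∀ i, a i ⬝ᵥ x ≤ 1)
    (hv : IsVertexOf (wedgeLift a w jv x)
      {z : (Fin m → ℝ) × (ι → Fin n → ℝ) | ∀ i j, a i ⬝ᵥ z.1 + b j ⬝ᵥ z.2 i ≤ 1}) :
    IsVertexOf x {x | ∀ i, a i ⬝ᵥ x ≤ 1} := by
  have := IsFaceOf.inter_preimage (wedgeLift a w jv) (C := {x | ∀ i, a i ⬝ᵥ x ≤ 1}) hv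
    fun y hy => h.wedgeLift_mem hy
  unfold IsVertexOf
  convert this using 1
  ext y
  simp only [mem_singleton_iff, mem_inter_iff, mem_preimage, mem_ofPred_eq,
    (wedgeLift_injective a w jv).eq_iff]
  exact ⟨fun hy => ⟨hy ▸ hx, hy⟩, fun hy => hy.2⟩

end IsSimplexFrame

end WedgeProduct

theorem exists_sum_eq_zero {ι A : Type*} [Fintype ι] [DecidableEq ι] [AddCommGroup A]
    (k : ι) (f : ι → A) : ∃ g : ι → A, ∑ i, g i = 0 ∧ ∀ i, i ≠ k → g i = f i :=
  ⟨f - Pi.single k (∑ i, f i), by simp, fun i hi => by simp [hi]⟩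

/-- For `p ≥ 3`, `q ≥ 2`, the subcomplex `Σ_{p,2q}` of the wedge
product `W_{p,q-1}` (consisting of the `p`-gons `(j̄_0,…,j̄_{p-1})` with
`Σ j_k ≡ 0, 1 (mod q)` together with their edges and vertices) contains **all** the
vertices of `W_{p,q-1}`, and its edges are exactly those encoded by vectors with one
entry `ZMod q` and all other entries complements of singletons.  Consequently its
f-vector is `(f_0, f_1, f_2) = (p·q^{p-2}, p·q^{p-1}, 2·q^{p-1})`. -/
theorem wedgeProductSurface_vertices_edges_fvector
    (p q : ℕ) [NeZero p] [NeZero q] (hp : 3 ≤ p) (hq : 2 ≤ q)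
    (a : ZMod p → Fin 2 → ℝ)
    (C : Set (Fin 2 → ℝ)) (hC : C = {x | ∀ i, a i ⬝ᵥ x ≤ 1})
    (hCbd : Bornology.IsBounded C) (hCdim : setDim C = 2)
    (hCfacets : ∀ i, IsFacetOf {x ∈ C | a i ⬝ᵥ x = 1} C)
    (hCinj : Function.Injective fun i => {x ∈ C | a i ⬝ᵥ x = 1})
    (hCall : ∀ G, IsFacetOf G C → ∃ i, G = {x ∈ C | a i ⬝ᵥ x = 1})
    (hCcyc : ∀ i i' : ZMod p,
      (∃ v, {x ∈ C | a i ⬝ᵥ x = 1} ∩ {x ∈ C | a i' ⬝ᵥ x = 1} = {v}) ↔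
        (i' = i + 1 ∨ i = i' + 1))
    (b : ZMod q → Fin (q - 1) → ℝ)
    (Δ : Set (Fin (q - 1) → ℝ)) (hΔ : Δ = {y | ∀ j, b j ⬝ᵥ y ≤ 1})
    (hΔbd : Bornology.IsBounded Δ) (hΔdim : setDim Δ = q - 1)
    (hΔfacets : ∀ j, IsFacetOf {y ∈ Δ | b j ⬝ᵥ y = 1} Δ)
    (hΔinj : Function.Injective fun j => {y ∈ Δ | b j ⬝ᵥ y = 1})
    (hΔall : ∀ G, IsFacetOf G Δ → ∃ j, G = {y ∈ Δ | b j ⬝ᵥ y = 1})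
    (hΔsimplex : ∀ j : ZMod q, ∃ w, IsVertexOf w Δ ∧
      {y ∈ Δ | ∀ j', j' ≠ j → b j' ⬝ᵥ y = 1} = {w})
    (W : Set ((Fin 2 → ℝ) × (ZMod p → Fin (q - 1) → ℝ)))
    (hW : W = {z | ∀ i j, a i ⬝ᵥ z.1 + b j ⬝ᵥ z.2 i ≤ 1})
    -- the `p`-gon face of `W` encoded by `(j̄_0, …, j̄_{p-1})`:
    (G : (ZMod p → ZMod q) → Set ((Fin 2 → ℝ) × (ZMod p → Fin (q - 1) → ℝ)))
    (hG : ∀ jv, G jv =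
      {z ∈ W | ∀ i, ∀ j', j' ≠ jv i → a i ⬝ᵥ z.1 + b j' ⬝ᵥ z.2 i = 1})
    -- the edge of `W` encoded by the vector with entry `ZMod q` at `k` and entries
    -- `j̄_i` elsewhere:
    (E : ZMod p → (ZMod p → ZMod q) → Set ((Fin 2 → ℝ) × (ZMod p → Fin (q - 1) → ℝ)))
    (hE : ∀ k jv, E k jv =
      {z ∈ W | (∀ j', a k ⬝ᵥ z.1 + b j' ⬝ᵥ z.2 k = 1) ∧
        ∀ i, i ≠ k → ∀ j', j' ≠ jv i → a i ⬝ᵥ z.1 + b j' ⬝ᵥ z.2 i = 1}) :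
    -- `Σ_{p,2q}` contains all the vertices of `W`:
    (∀ v, IsVertexOf v W →
      ∃ jv : ZMod p → ZMod q, ((∑ i, jv i) = 0 ∨ (∑ i, jv i) = 1) ∧ v ∈ G jv) ∧
    -- its edges are exactly those of the indicated type:
    {e | IsFaceOf e W ∧ e.Nonempty ∧ setDim e = 1 ∧
        ∃ jv : ZMod p → ZMod q, ((∑ i, jv i) = 0 ∨ (∑ i, jv i) = 1) ∧ e ⊆ G jv} =
      {e | ∃ k jv, e = E k jv} ∧
    -- the f-vector:
    {v | IsVertexOf v W ∧ ∃ jv : ZMod p → ZMod q,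
        ((∑ i, jv i) = 0 ∨ (∑ i, jv i) = 1) ∧ v ∈ G jv}.ncard = p * q ^ (p - 2) ∧
    {e | ∃ k jv, e = E k jv}.ncard = p * q ^ (p - 1) ∧
    {s | ∃ jv : ZMod p → ZMod q,
        ((∑ i, jv i) = 0 ∨ (∑ i, jv i) = 1) ∧ s = G jv}.ncard = 2 * q ^ (p - 1) := by

  subst hC hΔ hW
  have hqfact : Fact (1 < q) := ⟨by omega⟩
  have hainj : Function.Injective a := fun i i' h => hCinj (by simp only [h])
  obtain ⟨v, hvC, hvtight, hvuniq⟩ := exists_polygon_vertices hp hainj hCbd hCdim hCcyc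
  choose w hwv hwset using hΔsimplex
  have hwmem : ∀ j, w j ∈ {y ∈ {y | ∀ j, b j ⬝ᵥ y ≤ 1} | ∀ j', j' ≠ j → b j' ⬝ᵥ y = 1} :=
    fun j => hwset j ▸ mem_singleton (w j)
  obtain ⟨lam, hfr⟩ := exists_isSimplexFrame (by omega) (by rw [ZMod.card]; omega) b hΔbd hΔdim w
    (fun j => (hwmem j).2) (fun j => (hwmem j).1 j)
  have hGim : ∀ jv, G jv = wedgeLift a w jv '' {x | ∀ i, a i ⬝ᵥ x ≤ 1} := fun jv =>
    (hG jv).trans (hfr.image_wedgeLift jv)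
  have hEim : ∀ k jv, E k jv =
      wedgeLift a w jv '' {x ∈ {x | ∀ i, a i ⬝ᵥ x ≤ 1} | a k ⬝ᵥ x = 1} := fun k jv =>
    (hE k jv).trans (hfr.image_wedgeLift_tight jv k)
  have h2 : (2 : ZMod p) ≠ 0 := fun h => by
    have := Nat.le_of_dvd (by norm_num) ((ZMod.natCast_eq_zero_iff 2 p).mp (by exact_mod_cast h))
    omega
  have h1 : (1 : ZMod p) ≠ 0 := by
    have : Fact (1 < p) := ⟨by omega⟩
    exact one_ne_zero
  have hkk : ∀ k : ZMod p, k ≠ k + 1 := fun k h => h1 (by simpa using h)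
  have hvinj : Function.Injective v := fun k l hkl => by
    have hk := (hvtight l k).mp (hkl ▸ (hvtight k k).mpr (Or.inl rfl))
    have hl := (hvtight k l).mp (hkl ▸ (hvtight l l).mpr (Or.inl rfl))
    rcases hk with hk | hk
    · exact hk
    · rcases hl with hl | hl
      · exact hl.symm
      · exact (h2 (by linear_combination -hk - hl)).elim
  -- the vertices of the wedge product
  have hvert : ∀ z, IsVertexOf z {z : (Fin 2 → ℝ) × (ZMod p → Fin (q - 1) → ℝ) |
      ∀ i j, a i ⬝ᵥ z.1 + b j ⬝ᵥ z.2 i ≤ 1} ↔ ∃ k jv, z = wedgeLift a w jv (v k) := fun z => by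
    constructor
    · intro hz
      obtain ⟨jv, hjv⟩ := hfr.exists_eq_wedgeLift hz
      have hzC : ∀ i, a i ⬝ᵥ z.1 ≤ 1 := fun i => hfr.le_one (hz.1 (mem_singleton z) i)
      obtain ⟨i, i', hne, hi, hi'⟩ :=
        exists_two_tight_of_isVertexOf (hfr.isVertexOf_of_wedgeLift hzC (hjv ▸ hz))
      rcases adjacent_of_tight hainj hCcyc hzC hne hi hi' with h | h
      · exact ⟨i, jv, by rw [← hvuniq i z.1 hi (h ▸ hi')]; exact hjv⟩
      · exact ⟨i', jv, by rw [← hvuniq i' z.1 hi' (h ▸ hi)]; exact hjv⟩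
    · rintro ⟨k, jv, rfl⟩
      exact hfr.isVertexOf_wedgeLift jv (hvC k) fun y hy => hvuniq k y
        (hy _ ((hvtight k _).mpr (Or.inl rfl))) (hy _ ((hvtight k _).mpr (Or.inr rfl)))
  have hall : ∀ z, IsVertexOf z {z : (Fin 2 → ℝ) × (ZMod p → Fin (q - 1) → ℝ) |
      ∀ i j, a i ⬝ᵥ z.1 + b j ⬝ᵥ z.2 i ≤ 1} →
      ∃ jv : ZMod p → ZMod q, ((∑ i, jv i) = 0 ∨ (∑ i, jv i) = 1) ∧ z ∈ G jv := fun z hz => by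
    obtain ⟨k, jv, rfl⟩ := (hvert z).mp hz
    obtain ⟨jv', hsum, hjv'⟩ := exists_sum_eq_zero k jv
    refine ⟨jv', Or.inl hsum, ?_⟩
    rw [hGim]
    exact ⟨v k, hvC k, hfr.wedgeLift_eq_iff.mpr ⟨rfl, fun i hi =>
      hjv' i fun hik => hi ((hvtight k i).mpr (Or.inl hik))⟩⟩
  have hEcongr : ∀ k jv jv', (∀ i, i ≠ k → jv i = jv' i) → E k jv = E k jv' :=
    fun k jv jv' h => by
      rw [hEim, hEim]
      exact image_congr fun x hx => hfr.wedgeLift_eq_iff.mpr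
        ⟨rfl, fun i hi => h i fun hik => hi (hik ▸ hx.2)⟩
  have hfst : ∀ jv (s : Set (Fin 2 → ℝ)), Prod.fst '' (wedgeLift a w jv '' s) = s := fun jv s => by
    rw [image_image]
    exact image_id s
  have hEiff : ∀ k k' jv jv', E k jv = E k' jv' ↔
      k = k' ∧ ∀ i ∉ ({k} : Finset (ZMod p)), jv i = jv' i := fun k k' jv jv' => by
    constructor
    · intro h
      rw [hEim, hEim] at h
      have hk : k = k' := hCinj (by simpa only [hfst] using congrArg (Prod.fst '' ·) h)
      subst hk
      refine ⟨rfl, fun i hi => ?_⟩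
      rw [Finset.mem_singleton] at hi
      obtain ⟨x, hx, hxi⟩ : ∃ x ∈ {x ∈ {x | ∀ i, a i ⬝ᵥ x ≤ 1} | a k ⬝ᵥ x = 1},
          a i ⬝ᵥ x ≠ 1 := by
        by_cases hik : i = k + 1
        · refine ⟨v (k - 1), ⟨hvC _, (hvtight _ _).mpr (Or.inr (by ring))⟩, fun h0 => ?_⟩
          rcases (hvtight _ _).mp h0 with h0 | h0
          · exact h2 (by linear_combination h0 - hik)
          · exact hi (by linear_combination h0)
        · exact ⟨v k, ⟨hvC _, (hvtight _ _).mpr (Or.inl rfl)⟩, fun h0 =>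
            ((hvtight _ _).mp h0).elim hi hik⟩
      obtain ⟨x', -, hx'⟩ := h ▸ mem_image_of_mem (wedgeLift a w jv) hx
      obtain ⟨rfl, hj⟩ := hfr.wedgeLift_eq_iff.mp hx'
      exact (hj i hxi).symm
    · rintro ⟨rfl, h⟩
      exact hEcongr k jv jv' fun i hi => h i (by simpa using hi)
  have hEface : ∀ k jv, IsFaceOf (E k jv) {z : (Fin 2 → ℝ) × (ZMod p → Fin (q - 1) → ℝ) |
      ∀ i j, a i ⬝ᵥ z.1 + b j ⬝ᵥ z.2 i ≤ 1} := fun k jv => by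
    convert isFaceOf_wedge a b {s : ZMod p × ZMod q | s.1 = k ∨ s.2 ≠ jv s.1} using 1
    rw [hE]
    ext z
    refine and_congr_right fun _ => ⟨fun hz s hs => ?_, fun hz => ⟨fun j => hz (k, j) (Or.inl rfl),
      fun i _ j hj => hz (i, j) (Or.inr hj)⟩⟩
    by_cases hs1 : s.1 = k
    · rw [hs1]
      exact hz.1 s.2
    · exact hz.2 s.1 hs1 s.2 (hs.resolve_left hs1)
  have hGinj : Function.Injective G := fun jv jv' h => by
    rw [hGim, hGim] at h
    have h0 : (0 : Fin 2 → ℝ) ∈ {x | ∀ i, a i ⬝ᵥ x ≤ 1} := fun i => by simp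
    obtain ⟨x, -, hx⟩ := h ▸ mem_image_of_mem (wedgeLift a w jv) h0
    obtain ⟨rfl, hj⟩ := hfr.wedgeLift_eq_iff.mp hx
    exact funext fun i => (hj i (by simp)).symm
  refine ⟨hall, ?_, ?_, ?_, ?_⟩
  · ext e
    constructor
    · rintro ⟨hface, hne, hdim, jv, -, hsub⟩
      rw [hGim] at hsub
      have hpre := hface.inter_preimage (wedgeLift a w jv) (C := {x | ∀ i, a i ⬝ᵥ x ≤ 1})
        fun y hy => hfr.wedgeLift_mem hy
      have he : wedgeLift a w jv '' ({x | ∀ i, a i ⬝ᵥ x ≤ 1} ∩ wedgeLift a w jv ⁻¹' e) = e := by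
        rw [image_inter_preimage, inter_eq_right]
        exact hsub
      have hfacet : IsFacetOf ({x | ∀ i, a i ⬝ᵥ x ≤ 1} ∩ wedgeLift a w jv ⁻¹' e)
          {x | ∀ i, a i ⬝ᵥ x ≤ 1} := by
        refine ⟨hpre, image_nonempty.mp (he.symm ▸ hne), ?_⟩
        rw [← setDim_image _ (wedgeLift_injective a w jv), he, hdim, hCdim]
      obtain ⟨k, hk⟩ := hCall _ hfacet
      exact ⟨k, jv, by rw [hEim, ← hk, he]⟩
    · rintro ⟨k, jv, rfl⟩
      refine ⟨hEface k jv, ?_, ?_, ?_⟩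
      · rw [hEim]
        exact (hCfacets k).2.1.image _
      · rw [hEim, setDim_image _ (wedgeLift_injective a w jv)]
        have := (hCfacets k).2.2
        omega
      · obtain ⟨jv', hsum, hjv'⟩ := exists_sum_eq_zero k jv
        refine ⟨jv', Or.inl hsum, ?_⟩
        rw [hEcongr k jv jv' fun i hi => (hjv' i hi).symm, hEim, hGim]
        exact image_mono (sep_subset _ _)
  · have hset : {z | IsVertexOf z {z : (Fin 2 → ℝ) × (ZMod p → Fin (q - 1) → ℝ) |
        ∀ i j, a i ⬝ᵥ z.1 + b j ⬝ᵥ z.2 i ≤ 1} ∧ ∃ jv : ZMod p → ZMod q,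
        ((∑ i, jv i) = 0 ∨ (∑ i, jv i) = 1) ∧ z ∈ G jv} =
        {z | ∃ k jv, z = wedgeLift a w jv (v k)} := by
      ext z
      exact ⟨fun hz => (hvert z).mp hz.1, fun hz => ⟨(hvert z).mpr hz, hall z ((hvert z).mpr hz)⟩⟩
    rw [hset, ncard_labelled (fun k => {k, k + 1}) (fun k => Finset.card_pair (hkk k))
      fun k jv => wedgeLift a w jv (v k)]
    · simp only [ZMod.card]
    · intro k k' jv jv'
      simp only [hfr.wedgeLift_eq_iff, hvinj.eq_iff, hvtight, Finset.mem_insert,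
        Finset.mem_singleton, ne_eq]
  · rw [ncard_labelled (fun k => {k}) (fun k => Finset.card_singleton k) E hEiff]
    simp only [ZMod.card]
  · have hset : {s | ∃ jv : ZMod p → ZMod q,
        ((∑ i, jv i) = 0 ∨ (∑ i, jv i) = 1) ∧ s = G jv} =
        G '' ({jv | ∑ i, jv i = 0} ∪ {jv | ∑ i, jv i = 1}) := by
      ext s
      exact ⟨fun ⟨jv, h, hs⟩ => ⟨jv, h, hs.symm⟩, fun ⟨jv, h, hs⟩ => ⟨jv, h, hs.symm⟩⟩
    have hdisj : Disjoint {jv : ZMod p → ZMod q | ∑ i, jv i = 0} {jv | ∑ i, jv i = 1} :=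
      disjoint_left.mpr fun jv h h' => zero_ne_one ((Eq.symm h).trans h')
    rw [hset, ncard_image_of_injective _ hGinj, ncard_union_eq hdisj, ncard_sum_eq 0,
      ncard_sum_eq 0]
    simp only [ZMod.card]
    ring
end
end

section
/- For p ≥ 3 and q ≥ 2, the polytopal complex Σ_{p,2q} is combinatorially regular: its group of combinatorial automorphisms acts transitively on the flags (incident triples vertex ⊂ edge ⊂ 2-face) of Σ_{p,2q}. -/
open Set

noncomputable section

/-- Encoding vectors of the vertices of `Σ_{p,2q}`: two cyclically adjacent entries
equal to `ZMod q`, all other entries complements of singletons. -/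
def IsVertVec (p q : ℕ) (H : ZMod p → Set (ZMod q)) : Prop :=
  ∃ k : ZMod p, H k = Set.univ ∧ H (k + 1) = Set.univ ∧
    ∀ i, i ≠ k → i ≠ k + 1 → ∃ j : ZMod q, H i = {j}ᶜ

/-- Encoding vectors of the edges of `Σ_{p,2q}`: one entry equal to `ZMod q`, all
other entries complements of singletons. -/
def IsEdgeVec (p q : ℕ) (H : ZMod p → Set (ZMod q)) : Prop :=
  ∃ k : ZMod p, H k = Set.univ ∧ ∀ i, i ≠ k → ∃ j : ZMod q, H i = {j}ᶜ

/-- Encoding vectors of the `p`-gon faces of `Σ_{p,2q}`: all entries complements of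
singletons `j̄_i = ZMod q \ {j_i}`, with `Σ j_i ≡ 0` or `1 (mod q)`. -/
def IsPgonVec (p q : ℕ) [NeZero p] (H : ZMod p → Set (ZMod q)) : Prop :=
  ∃ jv : ZMod p → ZMod q, ((∑ i, jv i) = 0 ∨ (∑ i, jv i) = 1) ∧ ∀ i, H i = {jv i}ᶜ

/-- The faces of the polytopal complex `Σ_{p,2q}`, encoded by the vectors
`(H_0, …, H_{p-1})` of sets of facet labels. -/
def sigmaFaces (p q : ℕ) [NeZero p] : Set (ZMod p → Set (ZMod q)) :=
  {H | IsVertVec p q H ∨ IsEdgeVec p q H ∨ IsPgonVec p q H}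

/-- Inclusion of faces in terms of the encoding: the face encoded by `H` is contained
in the face encoded by `H'` iff every facet-label of `H'` is a facet-label of `H`. -/
def faceIncl {p q : ℕ} (H H' : ZMod p → Set (ZMod q)) : Prop :=
  ∀ i, H' i ⊆ H i

/-- The affine permutation `x ↦ u * x + a` of a commutative ring, for `u` an involutive unit. -/
def affinePerm {R : Type*} [CommRing R] (u a : R) (hu : u * u = 1) : R ≃ R where
  toFun x := u * x + a
  invFun y := u * (y - a)
  left_inv x := by linear_combination x * hu
  right_inv y := by linear_combination (y - a) * hu

/-- Permute the entries of an encoding vector by `σ` and relabel the `i`-th entry by `e i`. -/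
def permuteEntries {p q : ℕ} (σ : ZMod p ≃ ZMod p) (e : ZMod p → ZMod q ≃ ZMod q)
    (H : ZMod p → Set (ZMod q)) : ZMod p → Set (ZMod q) :=
  fun i => e i '' H (σ i)

section permuteEntries

variable {p q : ℕ} {σ : ZMod p ≃ ZMod p} {e : ZMod p → ZMod q ≃ ZMod q}
  {H : ZMod p → Set (ZMod q)}

theorem permuteEntries_apply_of_eq_univ {i : ZMod p} (h : H (σ i) = Set.univ) :
    permuteEntries σ e H i = Set.univ := by
  simp [permuteEntries, h]

theorem permuteEntries_apply_of_eq_compl {i : ZMod p} {j : ZMod q} (h : H (σ i) = {j}ᶜ) :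
    permuteEntries σ e H i = {e i j}ᶜ := by
  simp [permuteEntries, h, Set.image_compl_eq (e i).bijective]

theorem faceIncl_permuteEntries_iff {H' : ZMod p → Set (ZMod q)} :
    faceIncl H H' ↔ faceIncl (permuteEntries σ e H) (permuteEntries σ e H') := by
  simp only [faceIncl, permuteEntries, Set.image_subset_image_iff (e _).injective]
  exact (σ.forall_congr_right (q := fun i => H' i ⊆ H i)).symm

theorem permuteEntries_injective :
    Function.Injective (permuteEntries σ e : (ZMod p → Set (ZMod q)) → _) := by
  intro H H' h
  funext i
  have := congrFun h (σ.symm i)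
  simpa [permuteEntries, (e _).injective.image_injective.eq_iff] using this

theorem IsEdgeVec.permuteEntries (h : IsEdgeVec p q H) : IsEdgeVec p q (permuteEntries σ e H) := by
  obtain ⟨k, hk, hj⟩ := h
  refine ⟨σ.symm k, permuteEntries_apply_of_eq_univ (by simpa using hk), fun i hi => ?_⟩
  obtain ⟨j, hj⟩ := hj (σ i) (fun h => hi (by simp [← h]))
  exact ⟨_, permuteEntries_apply_of_eq_compl hj⟩

theorem IsVertVec.permuteEntries (hσ : (∀ i, σ (i + 1) = σ i + 1) ∨ ∀ i, σ (i + 1) + 1 = σ i)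
    (h : IsVertVec p q H) : IsVertVec p q (permuteEntries σ e H) := by
  obtain ⟨k, hk, hk', hj⟩ := h
  rcases hσ with hσ | hσ
  · have hs : σ (σ.symm k + 1) = k + 1 := by simp [hσ]
    refine ⟨σ.symm k, permuteEntries_apply_of_eq_univ (by simpa using hk),
      permuteEntries_apply_of_eq_univ (by rwa [hs]), fun i hi hi' => ?_⟩
    obtain ⟨j, hj⟩ := hj (σ i) (fun h => hi (by simp [← h]))
      (fun h => hi' (σ.injective (h.trans hs.symm)))
    exact ⟨_, permuteEntries_apply_of_eq_compl hj⟩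
  · have hs : σ (σ.symm (k + 1) + 1) = k := by
      have := hσ (σ.symm (k + 1))
      simpa using this
    refine ⟨σ.symm (k + 1), permuteEntries_apply_of_eq_univ (by simpa using hk'),
      permuteEntries_apply_of_eq_univ (by rwa [hs]), fun i hi hi' => ?_⟩
    obtain ⟨j, hj⟩ := hj (σ i) (fun h => hi' (σ.injective (h.trans hs.symm)))
      (fun h => hi (by simp [← h]))
    exact ⟨_, permuteEntries_apply_of_eq_compl hj⟩

theorem IsPgonVec.permuteEntries [NeZero p]
    (he : ∀ jv : ZMod p → ZMod q, ((∑ i, jv i) = 0 ∨ (∑ i, jv i) = 1) →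
      (∑ i, e i (jv i)) = 0 ∨ (∑ i, e i (jv i)) = 1)
    (h : IsPgonVec p q H) : IsPgonVec p q (permuteEntries σ e H) := by
  obtain ⟨jv, hs, hj⟩ := h
  refine ⟨fun i => e i (jv (σ i)), he (fun i => jv (σ i)) ?_,
    fun i => permuteEntries_apply_of_eq_compl (hj _)⟩
  rwa [Equiv.sum_comp σ jv]

end permuteEntries

theorem compl_singleton_ne_univ {α : Type*} (j : α) : ({j}ᶜ : Set α) ≠ Set.univ := by
  simp

/-- A flag consists of a `p`-gon, the edge obtained by freeing its coordinate `k`, and the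
vertex obtained by also freeing a coordinate cyclically adjacent to `k`. -/
theorem exists_flag_coordinates {p q : ℕ} [NeZero p] {V E G : ZMod p → Set (ZMod q)}
    (hV : IsVertVec p q V) (hE : IsEdgeVec p q E) (hG : IsPgonVec p q G)
    (hVE : faceIncl V E) (hEG : faceIncl E G) :
    ∃ (jv : ZMod p → ZMod q) (k s : ZMod p), (s = 1 ∨ s = -1) ∧
      ((∑ i, jv i) = 0 ∨ (∑ i, jv i) = 1) ∧ (∀ i, G i = {jv i}ᶜ) ∧
      E k = Set.univ ∧ (∀ i, i ≠ k → E i = {jv i}ᶜ) ∧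
      V k = Set.univ ∧ V (k + s) = Set.univ ∧
      ∀ i, i ≠ k → i ≠ k + s → V i = {jv i}ᶜ := by
  obtain ⟨jv, hs, hG⟩ := hG
  obtain ⟨k, hk, hE⟩ := hE
  obtain ⟨m, hm, hm', hV⟩ := hV
  have eq_of_subset {A : Set (ZMod q)} {i : ZMod p} (h : ({jv i}ᶜ : Set (ZMod q)) ⊆ A)
      (hA : ∃ j, A = {j}ᶜ) : A = {jv i}ᶜ := by
    obtain ⟨j, rfl⟩ := hA
    simp_all
  have hVk : V k = Set.univ := Set.univ_subset_iff.1 (hk ▸ hVE k)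
  have hkm : k = m ∨ k = m + 1 := by
    by_contra! h
    obtain ⟨j, hj⟩ := hV k h.1 h.2
    exact compl_singleton_ne_univ j (hj.symm.trans hVk)
  have hE' i (hi : i ≠ k) : E i = {jv i}ᶜ := eq_of_subset (hG i ▸ hEG i) (hE i hi)
  have hV' i (hi : i ≠ m) (hi' : i ≠ m + 1) : V i = {jv i}ᶜ :=
    eq_of_subset (hG i ▸ (hEG i).trans (hVE i)) (hV i hi hi')
  rcases hkm with rfl | rfl
  · exact ⟨jv, k, 1, .inl rfl, hs, hG, hk, hE', hVk, hm', hV'⟩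
  · refine ⟨jv, m + 1, -1, .inr rfl, hs, hG, hk, hE', hVk, by simpa using hm,
      fun i hi hi' => hV' i (by simpa using hi') hi⟩

/-- For `p ≥ 3` and `q ≥ 2`, the polytopal complex `Σ_{p,2q}` is
combinatorially regular: its group of combinatorial automorphisms (inclusion-preserving
bijections of the face poset) acts transitively on the flags
(vertex ⊂ edge ⊂ 2-face). -/
theorem sigmaSurface_flag_transitive
    (p q : ℕ) [NeZero p] [NeZero q] (hp : 3 ≤ p) (hq : 2 ≤ q)
    (V E G V' E' G' : ZMod p → Set (ZMod q))
    (hV : IsVertVec p q V) (hE : IsEdgeVec p q E) (hG : IsPgonVec p q G)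
    (hV' : IsVertVec p q V') (hE' : IsEdgeVec p q E') (hG' : IsPgonVec p q G')
    (hVE : faceIncl V E) (hEG : faceIncl E G)
    (hVE' : faceIncl V' E') (hEG' : faceIncl E' G') :
    ∃ φ : sigmaFaces p q ≃ sigmaFaces p q,
      (∀ X Y : sigmaFaces p q, faceIncl X.1 Y.1 ↔ faceIncl (φ X).1 (φ Y).1) ∧
      φ ⟨V, Or.inl hV⟩ = ⟨V', Or.inl hV'⟩ ∧
      φ ⟨E, Or.inr (Or.inl hE)⟩ = ⟨E', Or.inr (Or.inl hE')⟩ ∧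
      φ ⟨G, Or.inr (Or.inr hG)⟩ = ⟨G', Or.inr (Or.inr hG')⟩ := by
  obtain ⟨jv, k, s, hs, hS, hG₁, hEk, hE₁, hVk, hVs, hV₁⟩ :=
    exists_flag_coordinates hV hE hG hVE hEG
  obtain ⟨jv', k', s', hs', hS', hG₁', hEk', hE₁', hVk', hVs', hV₁'⟩ :=
    exists_flag_coordinates hV' hE' hG' hVE' hEG'
  have hu : s * s' = 1 ∨ s * s' = -1 := by
    rcases hs with rfl | rfl <;> rcases hs' with rfl | rfl <;> simp
  have hss : s' * s' = 1 := by rcases hs' with rfl | rfl <;> simp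
  have huu : s * s' * (s * s') = 1 := by rcases hu with h | h <;> simp [h]
  obtain ⟨σ, hσ⟩ : ∃ σ : ZMod p ≃ ZMod p, ∀ i, σ i = s * s' * (i - k') + k :=
    ⟨affinePerm (s * s') (k - s * s' * k') huu, fun i => by
      simp only [affinePerm, Equiv.coe_fn_mk]; ring⟩
  have hσk : σ k' = k := by simp [hσ]
  have hσs : σ (k' + s') = k + s := by rw [hσ]; linear_combination s * hss
  have hσadj : (∀ i, σ (i + 1) = σ i + 1) ∨ ∀ i, σ (i + 1) + 1 = σ i := by
    rcases hu with h | h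
    · left; intro i; simp only [hσ, h]; ring
    · right; intro i; simp only [hσ, h]; ring
  obtain ⟨δ, hδ, hδS⟩ : ∃ δ : ZMod q, δ * δ = 1 ∧
      (δ = 1 ∧ ∑ i, jv' i - δ * ∑ i, jv i = 0 ∨ δ = -1 ∧ ∑ i, jv' i - δ * ∑ i, jv i = 1) := by
    rcases hS with h | h <;> rcases hS' with h' | h' <;> rw [h, h']
    exacts [⟨1, by simp⟩, ⟨-1, by simp⟩, ⟨-1, by simp⟩, ⟨1, by simp⟩]
  let e (i : ZMod p) : ZMod q ≃ ZMod q := affinePerm δ (jv' i - δ * jv (σ i)) hδ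
  have he i : e i (jv (σ i)) = jv' i := by simp [e, affinePerm]
  have he_sum (x : ZMod p → ZMod q) (hx : (∑ i, x i) = 0 ∨ (∑ i, x i) = 1) :
      (∑ i, e i (x i)) = 0 ∨ (∑ i, e i (x i)) = 1 := by
    have : ∑ i, e i (x i) = δ * ∑ i, x i + (∑ i, jv' i - δ * ∑ i, jv i) := by
      simp only [e, affinePerm, Equiv.coe_fn_mk, Finset.sum_add_distrib,
        Finset.sum_sub_distrib, ← Finset.mul_sum, Equiv.sum_comp σ jv]
    rw [this]
    rcases hδS with ⟨h, h'⟩ | ⟨h, h'⟩ <;> rw [h', h] <;> rcases hx with hx | hx <;> simp [hx]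
  let f (X : sigmaFaces p q) : sigmaFaces p q :=
    ⟨permuteEntries σ e X.1, X.2.imp (.permuteEntries hσadj) (.imp .permuteEntries (.permuteEntries he_sum))⟩
  have hf : Function.Injective f := fun X Y h =>
    Subtype.ext (permuteEntries_injective (congrArg Subtype.val h))
  refine ⟨Equiv.ofBijective f (Finite.injective_iff_bijective.1 hf),
    fun X Y => faceIncl_permuteEntries_iff, Subtype.ext (funext fun i => ?_),
    Subtype.ext (funext fun i => ?_), Subtype.ext (funext fun i => ?_)⟩
  · change permuteEntries σ e V i = V' i
    by_cases hi : i = k'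
    · rw [hi, hVk', permuteEntries_apply_of_eq_univ (by rwa [hσk])]
    by_cases hi' : i = k' + s'
    · rw [hi', hVs', permuteEntries_apply_of_eq_univ (by rwa [hσs])]
    rw [hV₁' i hi hi', ← he, permuteEntries_apply_of_eq_compl]
    exact hV₁ _ (fun h => hi (σ.injective (h.trans hσk.symm)))
      (fun h => hi' (σ.injective (h.trans hσs.symm)))
  · change permuteEntries σ e E i = E' i
    by_cases hi : i = k'
    · rw [hi, hEk', permuteEntries_apply_of_eq_univ (by rwa [hσk])]
    rw [hE₁' i hi, ← he, permuteEntries_apply_of_eq_compl]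
    exact hE₁ _ (fun h => hi (σ.injective (h.trans hσk.symm)))
  · change permuteEntries σ e G i = G' i
    rw [hG₁' i, ← he, permuteEntries_apply_of_eq_compl (hG₁ _)]
end
end

section
/- For p ≥ 3 and q ≥ 2, the subcomplex Σ_{p,2q} of the wedge product W_{p,q−1} = C_p ⋈ Δ_{q−1} is a closed connected orientable combinatorially regular 2-manifold that is equivelar of type {p, 2q} (every 2-face is a p-gon and every vertex has degree 2q), with f-vector f(Σ_{p,2q}) = (p·q^{p−2}, p·q^{p−1}, 2·q^{p−1}) and genus g = 1 + (1/2)·q^{p−2}·(pq − p − 2q). -/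
open Set

noncomputable section

variable {p q : ℕ}

/-- The encoding vector that is full on `S` and omits exactly `v i` at each `i ∉ S`. -/
def encVec (S : Set (ZMod p)) (v : ZMod p → ZMod q) : ZMod p → Set (ZMod q) :=
  fun i => {x | i ∈ S ∨ x ≠ v i}

theorem encVec_of_mem {S : Set (ZMod p)} {v : ZMod p → ZMod q} {i : ZMod p} (h : i ∈ S) :
    encVec S v i = Set.univ := by
  simp [encVec, h]

theorem encVec_of_notMem {S : Set (ZMod p)} {v : ZMod p → ZMod q} {i : ZMod p} (h : i ∉ S) :
    encVec S v i = {v i}ᶜ := by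
  ext x; simp [encVec, h]

theorem encVec_eq_univ_iff {S : Set (ZMod p)} {v : ZMod p → ZMod q} {i : ZMod p} :
    encVec S v i = Set.univ ↔ i ∈ S := by
  refine ⟨fun h => ?_, encVec_of_mem⟩
  have : v i ∈ encVec S v i := h ▸ Set.mem_univ _
  simpa [encVec] using this

theorem faceIncl_encVec_iff {S T : Set (ZMod p)} {v w : ZMod p → ZMod q} :
    faceIncl (encVec T w) (encVec S v) ↔ S ⊆ T ∧ ∀ i, i ∉ T → w i = v i := by
  constructor
  · intro h
    have hST : S ⊆ T := fun i hi => by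
      have := h i
      rw [encVec_of_mem hi, Set.univ_subset_iff, encVec_eq_univ_iff] at this
      exact this
    refine ⟨hST, fun i hi => ?_⟩
    have := h i
    rw [encVec_of_notMem hi, encVec_of_notMem (fun h' => hi (hST h'))] at this
    simpa using this
  · rintro ⟨hST, h⟩ i x (hx | hx)
    · exact Or.inl (hST hx)
    · by_cases hi : i ∈ T
      · exact Or.inl hi
      · exact Or.inr (h i hi ▸ hx)

theorem encVec_congr {S : Set (ZMod p)} {v w : ZMod p → ZMod q} (h : ∀ i, i ∉ S → v i = w i) :
    encVec S v = encVec S w := by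
  funext i
  by_cases hi : i ∈ S
  · rw [encVec_of_mem hi, encVec_of_mem hi]
  · rw [encVec_of_notMem hi, encVec_of_notMem hi, h i hi]

theorem faceIncl_refl (H : ZMod p → Set (ZMod q)) : faceIncl H H := fun _ => subset_rfl

theorem encVec_inj {S T : Set (ZMod p)} {v w : ZMod p → ZMod q} :
    encVec S v = encVec T w ↔ S = T ∧ ∀ i, i ∉ T → v i = w i := by
  constructor
  · intro h
    have hST : S = T := by ext i; rw [← encVec_eq_univ_iff (v := v), h, encVec_eq_univ_iff]
    subst hST
    exact ⟨rfl, (faceIncl_encVec_iff.1 (h.subst (faceIncl_refl (encVec S v)))).2⟩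
  · rintro ⟨rfl, h⟩
    exact encVec_congr h

theorem encVec_empty_injective :
    Function.Injective (encVec (∅ : Set (ZMod p)) : (ZMod p → ZMod q) → _) := fun _ _ h =>
  funext fun i => (encVec_inj.1 h).2 i (Set.notMem_empty i)

theorem exists_eq_encVec {S : Set (ZMod p)} {H : ZMod p → Set (ZMod q)}
    (huniv : ∀ i ∈ S, H i = Set.univ) (hcompl : ∀ i, i ∉ S → ∃ j : ZMod q, H i = {j}ᶜ) :
    ∃ v, H = encVec S v := by
  choose! v hv using hcompl
  refine ⟨v, funext fun i => ?_⟩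
  by_cases hi : i ∈ S
  · rw [encVec_of_mem hi, huniv i hi]
  · rw [encVec_of_notMem hi, hv i hi]

theorem encVec_add_single {S : Set (ZMod p)} {k : ZMod p} (hk : k ∈ S) (v : ZMod p → ZMod q)
    (a : ZMod q) : encVec S (v + Pi.single k a) = encVec S v :=
  encVec_congr fun i hi => by
    have : i ≠ k := fun h => hi (h ▸ hk)
    simp [this]

theorem sum_add_single [NeZero p] (v : ZMod p → ZMod q) (k : ZMod p) (a : ZMod q) :
    ∑ i, (v + Pi.single k a : ZMod p → ZMod q) i = ∑ i, v i + a := by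
  simp [Finset.sum_add_distrib]

/-- An encoding vector with at least one full entry has a representative with zero sum. -/
theorem exists_encVec_eq_sum_zero [NeZero p] {S : Set (ZMod p)} {k : ZMod p} (hk : k ∈ S)
    (v : ZMod p → ZMod q) : ∃ w, encVec S v = encVec S w ∧ ∑ i, w i = 0 :=
  ⟨v + Pi.single k (-∑ i, v i), (encVec_add_single hk v _).symm, by rw [sum_add_single]; ring⟩

theorem isVertVec_encVec (k : ZMod p) (v : ZMod p → ZMod q) :
    IsVertVec p q (encVec {k, k + 1} v) :=
  ⟨k, encVec_of_mem (by simp), encVec_of_mem (by simp), fun i h h' =>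
    ⟨v i, encVec_of_notMem (by simp [h, h'])⟩⟩

theorem isVertVec_iff {H : ZMod p → Set (ZMod q)} :
    IsVertVec p q H ↔ ∃ k v, H = encVec {k, k + 1} v := by
  constructor
  · rintro ⟨k, h, h', hi⟩
    refine ⟨k, exists_eq_encVec ?_ fun i hik => ?_⟩
    · rintro i (rfl | rfl) <;> assumption
    · simp only [Set.mem_insert_iff, Set.mem_singleton_iff, not_or] at hik
      exact hi i hik.1 hik.2
  · rintro ⟨k, v, rfl⟩
    exact isVertVec_encVec k v

theorem isEdgeVec_encVec (k : ZMod p) (v : ZMod p → ZMod q) : IsEdgeVec p q (encVec {k} v) :=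
  ⟨k, encVec_of_mem (by simp), fun i h => ⟨v i, encVec_of_notMem (by simp [h])⟩⟩

theorem isEdgeVec_iff {H : ZMod p → Set (ZMod q)} :
    IsEdgeVec p q H ↔ ∃ k v, H = encVec {k} v := by
  constructor
  · rintro ⟨k, h, hi⟩
    refine ⟨k, exists_eq_encVec ?_ fun i hik => hi i hik⟩
    rintro i rfl
    exact h
  · rintro ⟨k, v, rfl⟩
    exact isEdgeVec_encVec k v

section Pgon

variable [NeZero p]

theorem isPgonVec_iff {H : ZMod p → Set (ZMod q)} :
    IsPgonVec p q H ↔ ∃ v, (∑ i, v i = 0 ∨ ∑ i, v i = 1) ∧ H = encVec ∅ v := by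
  refine exists_congr fun v => and_congr_right fun _ => ?_
  rw [funext_iff]
  exact forall_congr' fun i => by rw [encVec_of_notMem (Set.notMem_empty i)]

theorem isPgonVec_encVec {v : ZMod p → ZMod q} :
    IsPgonVec p q (encVec ∅ v) ↔ ∑ i, v i = 0 ∨ ∑ i, v i = 1 := by
  rw [isPgonVec_iff]
  constructor
  · rintro ⟨w, hw, h⟩
    rwa [encVec_empty_injective h]
  · exact fun h => ⟨v, h, rfl⟩

end Pgon

/-! ### Incidences between encoding vectors -/

theorem isVertVec_and_faceIncl_iff {H : ZMod p → Set (ZMod q)} {S : Set (ZMod p)}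
    {v : ZMod p → ZMod q} :
    IsVertVec p q H ∧ faceIncl H (encVec S v) ↔
      ∃ k, S ⊆ {k, k + 1} ∧ H = encVec {k, k + 1} v := by
  rw [isVertVec_iff]
  constructor
  · rintro ⟨⟨k, w, rfl⟩, h⟩
    rw [faceIncl_encVec_iff] at h
    exact ⟨k, h.1, encVec_congr h.2⟩
  · rintro ⟨k, h, rfl⟩
    exact ⟨⟨k, v, rfl⟩, faceIncl_encVec_iff.2 ⟨h, fun _ _ => rfl⟩⟩

theorem isEdgeVec_and_faceIncl_iff {H : ZMod p → Set (ZMod q)} {v : ZMod p → ZMod q} :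
    IsEdgeVec p q H ∧ faceIncl H (encVec ∅ v) ↔ ∃ k, H = encVec {k} v := by
  rw [isEdgeVec_iff]
  constructor
  · rintro ⟨⟨k, w, rfl⟩, h⟩
    rw [faceIncl_encVec_iff] at h
    exact ⟨k, encVec_congr h.2⟩
  · rintro ⟨k, rfl⟩
    exact ⟨⟨k, v, rfl⟩, faceIncl_encVec_iff.2 ⟨by simp, fun _ _ => rfl⟩⟩

theorem isPgonVec_and_faceIncl_edge_iff [NeZero p] {G : ZMod p → Set (ZMod q)} {k : ZMod p}
    {v : ZMod p → ZMod q} (hv : ∑ i, v i = 0) :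
    IsPgonVec p q G ∧ faceIncl (encVec {k} v) G ↔
      G = encVec ∅ v ∨ G = encVec ∅ (v + Pi.single k 1) := by
  constructor
  · rintro ⟨hG, h⟩
    obtain ⟨w, hw, rfl⟩ := isPgonVec_iff.1 hG
    have hwv : w = v + Pi.single k (w k - v k) := by
      funext i
      by_cases hi : i = k
      · subst hi; simp
      · simp [hi, (faceIncl_encVec_iff.1 h).2 i hi]
    rw [hwv, sum_add_single, hv, zero_add] at hw
    rcases hw with hw | hw <;> rw [hwv, hw] <;> simp
  · rintro (rfl | rfl)
    · exact ⟨isPgonVec_encVec.2 (Or.inl hv), faceIncl_encVec_iff.2 ⟨by simp, fun _ _ => rfl⟩⟩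
    · refine ⟨isPgonVec_encVec.2 (Or.inr (by rw [sum_add_single, hv, zero_add])), ?_⟩
      rw [← encVec_add_single (Set.mem_singleton k) v 1]
      exact faceIncl_encVec_iff.2 ⟨by simp, fun _ _ => rfl⟩

theorem isEdgeVec_and_vert_faceIncl_iff {E : ZMod p → Set (ZMod q)} {k : ZMod p}
    (hk : k + 1 ≠ k) {v : ZMod p → ZMod q} :
    IsEdgeVec p q E ∧ faceIncl (encVec {k, k + 1} v) E ↔
      (∃ a, E = encVec {k + 1} (v + Pi.single k a)) ∨
        ∃ b, E = encVec {k} (v + Pi.single (k + 1) b) := by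
  constructor
  · rintro ⟨hE, h⟩
    obtain ⟨l, w, rfl⟩ := isEdgeVec_iff.1 hE
    obtain ⟨hl, hw⟩ := faceIncl_encVec_iff.1 h
    simp only [Set.singleton_subset_iff, Set.mem_insert_iff, Set.mem_singleton_iff, not_or] at hl hw
    rcases hl with rfl | rfl
    · refine Or.inr ⟨w (l + 1) - v (l + 1), encVec_congr fun i hi => ?_⟩
      by_cases hi' : i = l + 1
      · subst hi'; simp
      · simp [hi', hw i ⟨hi, hi'⟩]
    · refine Or.inl ⟨w k - v k, encVec_congr fun i hi => ?_⟩
      by_cases hi' : i = k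
      · subst hi'; simp
      · simp [hi', hw i ⟨hi', hi⟩]
  · rintro (⟨a, rfl⟩ | ⟨b, rfl⟩)
    · refine ⟨isEdgeVec_encVec _ _, ?_⟩
      rw [← encVec_add_single (S := {k, k + 1}) (k := k) (by simp) v a]
      exact faceIncl_encVec_iff.2 ⟨by simp, fun _ _ => rfl⟩
    · refine ⟨isEdgeVec_encVec _ _, ?_⟩
      rw [← encVec_add_single (S := {k, k + 1}) (k := k + 1) (by simp) v b]
      exact faceIncl_encVec_iff.2 ⟨by simp, fun _ _ => rfl⟩

theorem isPgonVec_and_vert_faceIncl_iff [NeZero p] {G : ZMod p → Set (ZMod q)} {k : ZMod p}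
    (hk : k + 1 ≠ k) {v : ZMod p → ZMod q} (hv : ∑ i, v i = 0) :
    IsPgonVec p q G ∧ faceIncl (encVec {k, k + 1} v) G ↔
      ∃ a b, (a + b = 0 ∨ a + b = 1) ∧
        G = encVec ∅ (v + Pi.single k a + Pi.single (k + 1) b) := by
  constructor
  · rintro ⟨hG, h⟩
    obtain ⟨w, hw, rfl⟩ := isPgonVec_iff.1 hG
    have hwv : w = v + Pi.single k (w k - v k) + Pi.single (k + 1) (w (k + 1) - v (k + 1)) := by
      funext i
      by_cases hi : i = k
      · subst hi; simp [hk.symm]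
      · by_cases hi' : i = k + 1
        · subst hi'; simp [hk]
        · simp [hi, hi', (faceIncl_encVec_iff.1 h).2 i (by simp [hi, hi'])]
    refine ⟨_, _, ?_, congrArg _ hwv⟩
    rwa [hwv, sum_add_single, sum_add_single, hv, zero_add] at hw
  · rintro ⟨a, b, hab, rfl⟩
    refine ⟨isPgonVec_encVec.2 (by rwa [sum_add_single, sum_add_single, hv, zero_add]), ?_⟩
    rw [← encVec_add_single (S := {k, k + 1}) (k := k) (by simp) v a,
      ← encVec_add_single (S := {k, k + 1}) (k := k + 1) (by simp) _ b]
    exact faceIncl_encVec_iff.2 ⟨by simp, fun _ _ => rfl⟩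

/-! ### The cyclic index set -/

theorem zmod_one_ne_zero (hp : 2 ≤ p) : (1 : ZMod p) ≠ 0 := by
  have : Fact (1 < p) := ⟨hp⟩
  exact one_ne_zero

theorem zmod_two_ne_zero (hp : 3 ≤ p) : (2 : ZMod p) ≠ 0 := fun h => by
  have := Nat.le_of_dvd two_pos ((ZMod.natCast_eq_zero_iff 2 p).1 (by exact_mod_cast h))
  omega

theorem zmod_add_one_ne_self (hp : 2 ≤ p) (k : ZMod p) : k + 1 ≠ k := by
  simpa using zmod_one_ne_zero hp

theorem pair_add_one_injective (hp : 3 ≤ p) :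
    Function.Injective fun k : ZMod p => ({k, k + 1} : Set (ZMod p)) := by
  intro k m (h : ({k, k + 1} : Set (ZMod p)) = {m, m + 1})
  have hk : k ∈ ({m, m + 1} : Set (ZMod p)) := h ▸ Set.mem_insert _ _
  have hk' : k + 1 ∈ ({m, m + 1} : Set (ZMod p)) := h ▸ Set.mem_insert_of_mem _ rfl
  rcases hk with rfl | hk
  · rfl
  · rw [Set.mem_singleton_iff] at hk
    subst hk
    rcases hk' with hk' | hk'
    · exact (zmod_two_ne_zero hp (by linear_combination hk')).elim
    · exact (zmod_one_ne_zero (p := p) (by omega)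
        (by linear_combination (Set.mem_singleton_iff.1 hk'))).elim

/-! ### Local counts -/

theorem ncard_vert_of_pgon [NeZero p] (hp : 3 ≤ p) {G : ZMod p → Set (ZMod q)}
    (hG : IsPgonVec p q G) : {V | IsVertVec p q V ∧ faceIncl V G}.ncard = p := by
  obtain ⟨v, -, rfl⟩ := isPgonVec_iff.1 hG
  have : {V | IsVertVec p q V ∧ faceIncl V (encVec ∅ v)} =
      Set.range fun k : ZMod p => encVec {k, k + 1} v := by
    ext V
    rw [Set.mem_ofPred_eq, isVertVec_and_faceIncl_iff]
    simp [eq_comm]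
  rw [this, Set.ncard_range_of_injective, Nat.card_zmod]
  exact fun k m h => pair_add_one_injective hp (encVec_inj.1 h).1

theorem ncard_edge_of_pgon [NeZero p] {G : ZMod p → Set (ZMod q)}
    (hG : IsPgonVec p q G) : {E | IsEdgeVec p q E ∧ faceIncl E G}.ncard = p := by
  obtain ⟨v, -, rfl⟩ := isPgonVec_iff.1 hG
  have : {E | IsEdgeVec p q E ∧ faceIncl E (encVec ∅ v)} =
      Set.range fun k : ZMod p => encVec {k} v := by
    ext E
    rw [Set.mem_ofPred_eq, isEdgeVec_and_faceIncl_iff]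
    simp [eq_comm]
  rw [this, Set.ncard_range_of_injective, Nat.card_zmod]
  exact fun k m h => Set.singleton_injective (encVec_inj.1 h).1

theorem ncard_pgon_of_edge [NeZero p] (hq : 2 ≤ q) {E : ZMod p → Set (ZMod q)}
    (hE : IsEdgeVec p q E) : {G | IsPgonVec p q G ∧ faceIncl E G}.ncard = 2 := by
  obtain ⟨k, v', rfl⟩ := isEdgeVec_iff.1 hE
  obtain ⟨v, h, hv⟩ := exists_encVec_eq_sum_zero (Set.mem_singleton k) v'
  rw [h]
  have : {G | IsPgonVec p q G ∧ faceIncl (encVec {k} v) G} =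
      {encVec ∅ v, encVec ∅ (v + Pi.single k 1)} := by
    ext G
    exact isPgonVec_and_faceIncl_edge_iff hv
  rw [this, Set.ncard_pair]
  intro h
  have := congrFun (encVec_empty_injective h) k
  simp [zmod_one_ne_zero hq] at this

theorem ncard_vert_of_edge (hp : 3 ≤ p) {E : ZMod p → Set (ZMod q)}
    (hE : IsEdgeVec p q E) : {V | IsVertVec p q V ∧ faceIncl V E}.ncard = 2 := by
  obtain ⟨k, v, rfl⟩ := isEdgeVec_iff.1 hE
  have : {V | IsVertVec p q V ∧ faceIncl V (encVec {k} v)} =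
      {encVec {k, k + 1} v, encVec {k - 1, k - 1 + 1} v} := by
    ext V
    rw [Set.mem_ofPred_eq, isVertVec_and_faceIncl_iff]
    constructor
    · rintro ⟨m, hm, rfl⟩
      rcases Set.singleton_subset_iff.1 hm with rfl | rfl
      · exact Or.inl rfl
      · exact Or.inr (by simp)
    · rintro (rfl | rfl)
      · exact ⟨k, by simp, rfl⟩
      · exact ⟨k - 1, by simp, rfl⟩
  rw [this, Set.ncard_pair]
  intro h
  have := pair_add_one_injective hp (encVec_inj.1 h).1
  exact zmod_one_ne_zero (p := p) (by omega) (by linear_combination this)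

/-! ### Vertex links -/

/-- The edges around the vertex `encVec {k, k + 1} v`, in cyclic order. -/
def linkEdge (k : ZMod p) (v : ZMod p → ZMod q) (n : ℕ) : ZMod p → Set (ZMod q) :=
  if Even n then encVec {k + 1} (v + Pi.single k ((n / 2 : ℕ) : ZMod q))
  else encVec {k} (v + Pi.single (k + 1) (-((n / 2 : ℕ) : ZMod q)))

/-- The `p`-gons around the vertex `encVec {k, k + 1} v`, in cyclic order. -/
def linkPgon (k : ZMod p) (v : ZMod p → ZMod q) (n : ℕ) : ZMod p → Set (ZMod q) :=
  encVec ∅ (v + Pi.single k (((n + 1) / 2 : ℕ) : ZMod q) +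
    Pi.single (k + 1) (-((n / 2 : ℕ) : ZMod q)))

theorem linkEdge_two_mul (k : ZMod p) (v : ZMod p → ZMod q) (m : ℕ) :
    linkEdge k v (2 * m) = encVec {k + 1} (v + Pi.single k (m : ZMod q)) := by
  simp [linkEdge]

theorem linkEdge_two_mul_add_one (k : ZMod p) (v : ZMod p → ZMod q) (m : ℕ) :
    linkEdge k v (2 * m + 1) = encVec {k} (v + Pi.single (k + 1) (-(m : ZMod q))) := by
  have h : (2 * m + 1) / 2 = m := by omega
  rw [linkEdge, if_neg (by simp), h]

theorem linkPgon_two_mul (k : ZMod p) (v : ZMod p → ZMod q) (m : ℕ) :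
    linkPgon k v (2 * m) =
      encVec ∅ (v + Pi.single k (m : ZMod q) + Pi.single (k + 1) (-(m : ZMod q))) := by
  have h : (2 * m + 1) / 2 = m := by omega
  simp [linkPgon, h]

theorem linkPgon_two_mul_add_one (k : ZMod p) (v : ZMod p → ZMod q) (m : ℕ) :
    linkPgon k v (2 * m + 1) =
      encVec ∅ (v + Pi.single k ((m : ZMod q) + 1) + Pi.single (k + 1) (-(m : ZMod q))) := by
  have h : (2 * m + 1) / 2 = m := by omega
  have h' : (2 * m + 1 + 1) / 2 = m + 1 := by omega
  simp [linkPgon, h, h']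

theorem linkEdge_periodic (k : ZMod p) (v : ZMod p → ZMod q) :
    Function.Periodic (linkEdge k v) (2 * q) := fun n => by
  have h : (n + 2 * q) / 2 = n / 2 + q := by omega
  simp [linkEdge, h, Nat.even_add]

theorem linkPgon_periodic (k : ZMod p) (v : ZMod p → ZMod q) :
    Function.Periodic (linkPgon k v) (2 * q) := fun n => by
  have h : (n + 2 * q) / 2 = n / 2 + q := by omega
  have h' : (n + 2 * q + 1) / 2 = (n + 1) / 2 + q := by omega
  simp [linkPgon, h, h']

theorem natCast_inj_of_lt {m n : ℕ} (hm : m < q) (hn : n < q) (h : (m : ZMod q) = n) : m = n := by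
  rwa [ZMod.natCast_eq_natCast_iff', Nat.mod_eq_of_lt hm, Nat.mod_eq_of_lt hn] at h

theorem linkEdge_injOn {k : ZMod p} (hk : k + 1 ≠ k) (v : ZMod p → ZMod q) {m n : ℕ}
    (hm : m < 2 * q) (hn : n < 2 * q) (h : linkEdge k v m = linkEdge k v n) : m = n := by
  obtain ⟨a, rfl | rfl⟩ := m.even_or_odd' <;> obtain ⟨b, rfl | rfl⟩ := n.even_or_odd'
  · rw [linkEdge_two_mul, linkEdge_two_mul, encVec_inj] at h
    rw [natCast_inj_of_lt (q := q) (m := a) (n := b) (by omega) (by omega)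
      (by simpa using h.2 k (by simp [hk.symm]))]
  · rw [linkEdge_two_mul, linkEdge_two_mul_add_one, encVec_inj] at h
    exact (hk (Set.singleton_injective h.1)).elim
  · rw [linkEdge_two_mul, linkEdge_two_mul_add_one, encVec_inj] at h
    exact (hk (Set.singleton_injective h.1).symm).elim
  · rw [linkEdge_two_mul_add_one, linkEdge_two_mul_add_one, encVec_inj] at h
    rw [natCast_inj_of_lt (q := q) (m := a) (n := b) (by omega) (by omega)
      (by simpa using h.2 (k + 1) (by simp [hk]))]

theorem linkPgon_injOn (hq : 2 ≤ q) {k : ZMod p} (hk : k + 1 ≠ k) (v : ZMod p → ZMod q) {m n : ℕ}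
    (hm : m < 2 * q) (hn : n < 2 * q) (h : linkPgon k v m = linkPgon k v n) : m = n := by
  have h1 := zmod_one_ne_zero hq
  have h := encVec_empty_injective h
  have hs := natCast_inj_of_lt (q := q) (m := m / 2) (n := n / 2) (by omega) (by omega)
    (by simpa [hk] using congrFun h (k + 1))
  have ht := congrFun h k
  obtain ⟨a, rfl | rfl⟩ := m.even_or_odd' <;> obtain ⟨b, rfl | rfl⟩ := n.even_or_odd'
  · omega
  · obtain rfl : a = b := by omega
    rw [show (2 * a + 1) / 2 = a by omega, show (2 * a + 1 + 1) / 2 = a + 1 by omega] at ht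
    simp [hk.symm, h1] at ht
  · obtain rfl : a = b := by omega
    rw [show (2 * a + 1) / 2 = a by omega, show (2 * a + 1 + 1) / 2 = a + 1 by omega] at ht
    simp [hk.symm, h1] at ht
  · omega

/-- The link of every vertex is a single cycle of length `2q`. -/
theorem exists_link_cycle [NeZero p] [NeZero q] (hp : 3 ≤ p) (hq : 2 ≤ q)
    {V : ZMod p → Set (ZMod q)} (hV : IsVertVec p q V) :
    ∃ e g : ZMod (2 * q) → (ZMod p → Set (ZMod q)),
      Function.Injective e ∧ Function.Injective g ∧
      (∀ t, IsEdgeVec p q (e t) ∧ faceIncl V (e t)) ∧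
      (∀ t, IsPgonVec p q (g t) ∧ faceIncl V (g t)) ∧
      (∀ E', IsEdgeVec p q E' → faceIncl V E' → ∃ t, E' = e t) ∧
      (∀ G', IsPgonVec p q G' → faceIncl V G' → ∃ t, G' = g t) ∧
      (∀ t, faceIncl (e t) (g t) ∧ faceIncl (e (t + 1)) (g t)) := by
  obtain ⟨k, v', rfl⟩ := isVertVec_iff.1 hV
  obtain ⟨v, h, hv⟩ := exists_encVec_eq_sum_zero (Set.mem_insert k {k + 1}) v'
  rw [h]
  have hk := zmod_add_one_ne_self (p := p) (by omega) k
  have : Fact (1 < 2 * q) := ⟨by omega⟩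
  have : NeZero (2 * q) := ⟨by omega⟩
  have he (n : ℕ) : linkEdge k v (n : ZMod (2 * q)).val = linkEdge k v n := by
    rw [ZMod.val_natCast, (linkEdge_periodic k v).map_mod_nat]
  have hg (n : ℕ) : linkPgon k v (n : ZMod (2 * q)).val = linkPgon k v n := by
    rw [ZMod.val_natCast, (linkPgon_periodic k v).map_mod_nat]
  refine ⟨fun t => linkEdge k v t.val, fun t => linkPgon k v t.val,
    fun s t hst => ZMod.val_injective _ (linkEdge_injOn hk v s.val_lt t.val_lt hst),
    fun s t hst => ZMod.val_injective _ (linkPgon_injOn hq hk v s.val_lt t.val_lt hst),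
    fun t => ?_, fun t => ?_, fun E' hE' hVE => ?_, fun G' hG' hVG => ?_, fun t => ?_⟩
  · obtain ⟨m, hm | hm⟩ := t.val.even_or_odd' <;>
      simp only [hm, linkEdge_two_mul, linkEdge_two_mul_add_one, isEdgeVec_and_vert_faceIncl_iff hk]
    · exact Or.inl ⟨_, rfl⟩
    · exact Or.inr ⟨_, rfl⟩
  · obtain ⟨m, hm | hm⟩ := t.val.even_or_odd' <;>
      simp only [hm, linkPgon_two_mul, linkPgon_two_mul_add_one,
        isPgonVec_and_vert_faceIncl_iff hk hv]
    · exact ⟨_, _, Or.inl (by ring), rfl⟩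
    · exact ⟨_, _, Or.inr (by ring), rfl⟩
  · rcases (isEdgeVec_and_vert_faceIncl_iff hk).1 ⟨hE', hVE⟩ with ⟨a, rfl⟩ | ⟨b, rfl⟩
    · refine ⟨((2 * a.val : ℕ) : ZMod (2 * q)), ?_⟩
      simp only [he, linkEdge_two_mul, ZMod.natCast_val, ZMod.cast_id', id]
    · refine ⟨((2 * (-b).val + 1 : ℕ) : ZMod (2 * q)), ?_⟩
      simp only [he, linkEdge_two_mul_add_one, ZMod.natCast_val, ZMod.cast_id', id, neg_neg]
  · obtain ⟨a, b, hab | hab, rfl⟩ := (isPgonVec_and_vert_faceIncl_iff hk hv).1 ⟨hG', hVG⟩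
    · refine ⟨((2 * a.val : ℕ) : ZMod (2 * q)), ?_⟩
      simp only [hg, linkPgon_two_mul, ZMod.natCast_val, ZMod.cast_id', id]
      rw [show b = -a by linear_combination hab]
    · refine ⟨((2 * (-b).val + 1 : ℕ) : ZMod (2 * q)), ?_⟩
      simp only [hg, linkPgon_two_mul_add_one, ZMod.natCast_val, ZMod.cast_id', id, neg_neg]
      rw [show a = -b + 1 by linear_combination hab]
  · have hsucc : linkEdge k v (t + 1).val = linkEdge k v (t.val + 1) := by
      rw [ZMod.val_add, ZMod.val_one, (linkEdge_periodic k v).map_mod_nat]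
    simp only [hsucc]
    obtain ⟨m, hm | hm⟩ := t.val.even_or_odd' <;> rw [hm]
    · rw [linkEdge_two_mul, linkEdge_two_mul_add_one, linkPgon_two_mul, faceIncl_encVec_iff,
        faceIncl_encVec_iff]
      refine ⟨⟨by simp, fun i hi => ?_⟩, ⟨by simp, fun i hi => ?_⟩⟩ <;>
        simp [Set.mem_singleton_iff.not.1 hi]
    · rw [show 2 * m + 1 + 1 = 2 * (m + 1) by ring, linkEdge_two_mul, linkEdge_two_mul_add_one,
        linkPgon_two_mul_add_one, faceIncl_encVec_iff, faceIncl_encVec_iff]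
      refine ⟨⟨by simp, fun i hi => ?_⟩, ⟨by simp, fun i hi => ?_⟩⟩ <;>
        simp [Set.mem_singleton_iff.not.1 hi]

theorem ncard_edge_of_vert [NeZero p] [NeZero q] (hp : 3 ≤ p) (hq : 2 ≤ q)
    {V : ZMod p → Set (ZMod q)} (hV : IsVertVec p q V) :
    {E | IsEdgeVec p q E ∧ faceIncl V E}.ncard = 2 * q := by
  obtain ⟨e, -, hinj, -, he, -, hsurj, -⟩ := exists_link_cycle hp hq hV
  have : {E | IsEdgeVec p q E ∧ faceIncl V E} = Set.range e :=
    Set.Subset.antisymm (fun E hE => (hsurj E hE.1 hE.2).imp fun _ h => h.symm)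
      (Set.range_subset_iff.2 he)
  rw [this, Set.ncard_range_of_injective hinj, Nat.card_zmod]

theorem ncard_pgon_of_vert [NeZero p] [NeZero q] (hp : 3 ≤ p) (hq : 2 ≤ q)
    {V : ZMod p → Set (ZMod q)} (hV : IsVertVec p q V) :
    {G | IsPgonVec p q G ∧ faceIncl V G}.ncard = 2 * q := by
  obtain ⟨-, g, -, hinj, -, hg, -, hsurj, -⟩ := exists_link_cycle hp hq hV
  have : {G | IsPgonVec p q G ∧ faceIncl V G} = Set.range g :=
    Set.Subset.antisymm (fun G hG => (hsurj G hG.1 hG.2).imp fun _ h => h.symm)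
      (Set.range_subset_iff.2 hg)
  rw [this, Set.ncard_range_of_injective hinj, Nat.card_zmod]

/-! ### The f-vector -/

theorem ncard_mul_eq_ncard_mul {α β : Type*} [Finite α] [Finite β] {P : α → Prop} {Q : β → Prop}
    {r : α → β → Prop} {m n : ℕ} (hm : ∀ a, P a → {b | Q b ∧ r a b}.ncard = m)
    (hn : ∀ b, Q b → {a | P a ∧ r a b}.ncard = n) :
    {a | P a}.ncard * m = {b | Q b}.ncard * n := by
  classical
  have := Fintype.ofFinite α
  have := Fintype.ofFinite β
  have key := Finset.card_mul_eq_card_mul (s := {a | P a}) (t := {b | Q b}) r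
    (m := m) (n := n) (fun a ha => ?_) (fun b hb => ?_)
  · simpa [Set.ncard_eq_toFinset_card'] using key
  · rw [← hm a (by simpa using ha), Set.ncard_eq_toFinset_card']
    congr 1
    ext b
    simp [Finset.bipartiteAbove]
  · rw [← hn b (by simpa using hb), Set.ncard_eq_toFinset_card']
    congr 1
    ext a
    simp [Finset.bipartiteBelow]

theorem card_sum_eq [NeZero p] [NeZero q] (s : ZMod q) :
    {v : ZMod p → ZMod q | ∑ i, v i = s}.ncard = q ^ (p - 1) := by
  have hconst (s : ZMod q) : {v : ZMod p → ZMod q | ∑ i, v i = s}.ncard =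
      {v : ZMod p → ZMod q | ∑ i, v i = 0}.ncard := by
    rw [← Set.ncard_image_of_injective {v : ZMod p → ZMod q | ∑ i, v i = 0}
      (add_left_injective (Pi.single 0 s))]
    congr 1
    ext v
    simp only [Set.mem_image, Set.mem_ofPred_eq]
    constructor
    · rintro rfl
      refine ⟨v + Pi.single 0 (-∑ i, v i), by rw [sum_add_single]; ring, ?_⟩
      rw [add_assoc, ← Pi.single_add]
      simp
    · rintro ⟨w, hw, rfl⟩
      rw [sum_add_single, hw, zero_add]
  have key := ncard_mul_eq_ncard_mul (P := fun _ : ZMod p → ZMod q => True)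
    (Q := fun _ : ZMod q => True) (r := fun v s => ∑ i, v i = s) (m := 1)
    (n := {v : ZMod p → ZMod q | ∑ i, v i = 0}.ncard)
    (fun v _ => by simp) (fun s _ => by simpa using hconst s)
  have hpq : q ^ p = q * {v : ZMod p → ZMod q | ∑ i, v i = 0}.ncard := by
    simpa [Set.ncard_univ, Nat.card_eq_fintype_card] using key
  rw [hconst]
  refine Nat.eq_of_mul_eq_mul_left (NeZero.pos q) ?_
  rw [← hpq, ← pow_succ', Nat.sub_add_cancel (NeZero.pos p)]

theorem ncard_isPgonVec [NeZero p] [NeZero q] (hq : 2 ≤ q) :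
    {H | IsPgonVec p q H}.ncard = 2 * q ^ (p - 1) := by
  have h : {H | IsPgonVec p q H} =
      encVec ∅ '' ({v | ∑ i, v i = 0} ∪ {v | ∑ i, v i = 1}) := by
    ext H
    simp only [Set.mem_ofPred_eq, isPgonVec_iff, Set.mem_image, Set.mem_union, eq_comm (a := H)]
  rw [h, Set.ncard_image_of_injective _ encVec_empty_injective, Set.ncard_union_eq ?_, card_sum_eq,
    card_sum_eq, two_mul]
  rw [Set.disjoint_left]
  intro v (hv : _ = _) (hv' : _ = _)
  exact zmod_one_ne_zero hq (hv' ▸ hv)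

theorem ncard_isEdgeVec [NeZero p] [NeZero q] (hq : 2 ≤ q) :
    {H | IsEdgeVec p q H}.ncard = p * q ^ (p - 1) := by
  have key := ncard_mul_eq_ncard_mul (fun E => ncard_pgon_of_edge (p := p) hq (E := E))
    (fun G => ncard_edge_of_pgon (p := p) (q := q) (G := G))
  rw [ncard_isPgonVec hq] at key
  linarith

theorem ncard_isVertVec [NeZero p] [NeZero q] (hp : 3 ≤ p) (hq : 2 ≤ q) :
    {H | IsVertVec p q H}.ncard = p * q ^ (p - 2) := by
  have key := ncard_mul_eq_ncard_mul (fun V => ncard_pgon_of_vert (p := p) hp hq (V := V))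
    (fun G => ncard_vert_of_pgon (p := p) (q := q) hp (G := G))
  rw [ncard_isPgonVec hq, show p - 1 = p - 2 + 1 by omega, pow_succ] at key
  refine Nat.eq_of_mul_eq_mul_right (show 0 < 2 * q by omega) (key.trans ?_)
  ring

/-! ### Connectedness -/

section Connected

variable [NeZero p]

/-- Two `p`-gons that share an edge. -/
def PgonAdj (G G' : ZMod p → Set (ZMod q)) : Prop :=
  IsPgonVec p q G ∧ IsPgonVec p q G' ∧ ∃ E, IsEdgeVec p q E ∧ faceIncl E G ∧ faceIncl E G'

theorem PgonAdj.symm {G G' : ZMod p → Set (ZMod q)} (h : PgonAdj G G') : PgonAdj G' G :=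
  ⟨h.2.1, h.1, h.2.2.imp fun _ hE => ⟨hE.1, hE.2.2, hE.2.1⟩⟩

theorem pgonAdj_add_single {v : ZMod p → ZMod q} (hv : ∑ i, v i = 0) (k : ZMod p) :
    PgonAdj (encVec ∅ v) (encVec ∅ (v + Pi.single k 1)) :=
  have h := (isPgonVec_and_faceIncl_edge_iff (k := k) hv).2 (Or.inl rfl)
  have h' := (isPgonVec_and_faceIncl_edge_iff (k := k) hv).2 (Or.inr rfl)
  ⟨h.1, h'.1, _, isEdgeVec_encVec k v, h.2, h'.2⟩

theorem reflTransGen_of_sum_eq_zero [NeZero q] {v w : ZMod p → ZMod q} (hv : ∑ i, v i = 0)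
    (hw : ∑ i, w i = 0) : Relation.ReflTransGen PgonAdj (encVec ∅ v) (encVec ∅ w) := by
  let T : AddSubmonoid (ZMod p → ZMod q) :=
    { carrier := {d | ∀ v : ZMod p → ZMod q, ∑ i, v i = 0 →
        ∑ i, (v + d) i = 0 ∧ Relation.ReflTransGen PgonAdj (encVec ∅ v) (encVec ∅ (v + d))}
      zero_mem' := fun v hv => by simpa using ⟨hv, .refl⟩
      add_mem' := fun {a b} ha hb v hv => by
        obtain ⟨h, h'⟩ := ha v hv
        obtain ⟨h₂, h₂'⟩ := hb _ h
        rw [← add_assoc]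
        exact ⟨h₂, h'.trans h₂'⟩ }
  have hgen (i : ZMod p) : Pi.single i 1 - Pi.single 0 1 ∈ T := fun v hv => by
    have hsum : ∑ j, (v + (Pi.single i 1 - Pi.single 0 1) : ZMod p → ZMod q) j = 0 := by
      simp [Finset.sum_add_distrib, hv]
    refine ⟨hsum, (Relation.ReflTransGen.single (pgonAdj_add_single hv i)).tail ?_⟩
    have := (pgonAdj_add_single hsum 0).symm
    rwa [add_assoc, sub_add_cancel] at this
  have hd : ∑ i, (w i - v i).val • (Pi.single i 1 - Pi.single 0 1 : ZMod p → ZMod q) = w - v := by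
    funext j
    have h0 : ∑ i, (w i - v i) = 0 := by rw [Finset.sum_sub_distrib, hv, hw, sub_zero]
    simp only [Finset.sum_apply, Pi.smul_apply, Pi.sub_apply]
    simp only [nsmul_eq_mul, ZMod.natCast_val, ZMod.cast_id', id, mul_sub (w _ - v _)]
    rw [Finset.sum_sub_distrib, ← Finset.sum_mul, h0]
    simp [Pi.single_apply]
  have := (hd ▸ T.sum_mem fun i _ => T.nsmul_mem (hgen i) _ : w - v ∈ T) v hv
  simpa using this.2

theorem reflTransGen_pgonAdj [NeZero q] {G G' : ZMod p → Set (ZMod q)} (hG : IsPgonVec p q G)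
    (hG' : IsPgonVec p q G') : Relation.ReflTransGen PgonAdj G G' := by
  have key {G : ZMod p → Set (ZMod q)} (hG : IsPgonVec p q G) : ∃ v : ZMod p → ZMod q,
      ∑ i, v i = 0 ∧ Relation.ReflTransGen PgonAdj G (encVec ∅ v) ∧
        Relation.ReflTransGen PgonAdj (encVec ∅ v) G := by
    obtain ⟨v, hv | hv, rfl⟩ := isPgonVec_iff.1 hG
    · exact ⟨v, hv, .refl, .refl⟩
    · have h0 : ∑ i, (v + Pi.single 0 (-1) : ZMod p → ZMod q) i = 0 := by
        rw [sum_add_single, hv]; ring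
      have h := pgonAdj_add_single h0 0
      rw [add_assoc, ← Pi.single_add, neg_add_cancel, Pi.single_zero, add_zero] at h
      exact ⟨_, h0, .single h.symm, .single h⟩
  obtain ⟨v, hv, h, -⟩ := key hG
  obtain ⟨w, hw, -, h'⟩ := key hG'
  exact (h.trans (reflTransGen_of_sum_eq_zero hv hw)).trans h'

theorem exists_pgon_path {G G' : ZMod p → Set (ZMod q)} (hG' : IsPgonVec p q G')
    (h : Relation.ReflTransGen PgonAdj G G') :
    ∃ (n : ℕ) (c : Fin (n + 1) → (ZMod p → Set (ZMod q))),
      (∀ k, IsPgonVec p q (c k)) ∧ c 0 = G ∧ c (Fin.last n) = G' ∧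
      ∀ k : Fin n, ∃ E, IsEdgeVec p q E ∧
        faceIncl E (c k.castSucc) ∧ faceIncl E (c k.succ) := by
  induction h using Relation.ReflTransGen.head_induction_on with
  | refl => exact ⟨0, fun _ => G', fun _ => hG', rfl, rfl, fun k => k.elim0⟩
  | @head G₁ G₂ hadj _ ih =>
    obtain ⟨n, c, hc, h0, hlast, hadj'⟩ := ih
    refine ⟨n + 1, Fin.cons G₁ c, Fin.cases hadj.1 hc, rfl, ?_, Fin.cases ?_ fun k => ?_⟩
    · rw [← Fin.succ_last, Fin.cons_succ, hlast]
    · rw [Fin.castSucc_zero, Fin.cons_zero, Fin.cons_succ, h0]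
      exact hadj.2.2
    · rw [← Fin.succ_castSucc, Fin.cons_succ, Fin.cons_succ]
      exact hadj' k

end Connected

/-! ### Flag transitivity -/

/-- The relabelling of encoding vectors by a permutation `σ` of the coordinates and permutations
`f i` of the labels. -/
def relabel (σ : Equiv.Perm (ZMod p)) (f : ZMod p → Equiv.Perm (ZMod q))
    (H : ZMod p → Set (ZMod q)) : ZMod p → Set (ZMod q) :=
  fun i => f i '' H (σ i)

theorem relabel_encVec (σ : Equiv.Perm (ZMod p)) (f : ZMod p → Equiv.Perm (ZMod q))
    (S : Set (ZMod p)) (v : ZMod p → ZMod q) :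
    relabel σ f (encVec S v) = encVec (σ ⁻¹' S) fun i => f i (v (σ i)) := by
  funext i
  by_cases hi : σ i ∈ S
  · rw [relabel, encVec_of_mem hi, encVec_of_mem (S := σ ⁻¹' S) hi, Set.image_univ,
      (f i).surjective.range_eq]
  · rw [relabel, encVec_of_notMem hi, encVec_of_notMem (S := σ ⁻¹' S) hi,
      Set.image_compl_eq (f i).bijective, Set.image_singleton]

theorem faceIncl_relabel_iff (σ : Equiv.Perm (ZMod p)) (f : ZMod p → Equiv.Perm (ZMod q))
    {H H' : ZMod p → Set (ZMod q)} :
    faceIncl (relabel σ f H) (relabel σ f H') ↔ faceIncl H H' := by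
  simp only [faceIncl, relabel, Set.image_subset_image_iff (f _).injective]
  exact σ.forall_congr_right (q := fun i => H' i ⊆ H i)

theorem relabel_injective (σ : Equiv.Perm (ZMod p)) (f : ZMod p → Equiv.Perm (ZMod q)) :
    Function.Injective (relabel σ f) := by
  intro H H' h
  funext i
  have := congrFun h (σ.symm i)
  simpa [relabel, (f _).injective.image_injective.eq_iff] using this

theorem preimage_singleton_perm (σ : Equiv.Perm (ZMod p)) (k : ZMod p) :
    σ ⁻¹' {k} = {σ.symm k} := by
  ext i; simp [Equiv.eq_symm_apply]

theorem relabel_mem_sigmaFaces [NeZero p] {σ : Equiv.Perm (ZMod p)}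
    {f : ZMod p → Equiv.Perm (ZMod q)}
    (hσ : ∀ k, ∃ m, σ ⁻¹' {k, k + 1} = ({m, m + 1} : Set (ZMod p)))
    (hf : ∀ v : ZMod p → ZMod q, ∑ i, v i = 0 ∨ ∑ i, v i = 1 →
      ∑ i, f i (v (σ i)) = 0 ∨ ∑ i, f i (v (σ i)) = 1)
    {H : ZMod p → Set (ZMod q)} (hH : H ∈ sigmaFaces p q) : relabel σ f H ∈ sigmaFaces p q := by
  rcases hH with hH | hH | hH
  · obtain ⟨k, v, rfl⟩ := isVertVec_iff.1 hH
    obtain ⟨m, hm⟩ := hσ k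
    rw [relabel_encVec, hm]
    exact Or.inl (isVertVec_encVec _ _)
  · obtain ⟨k, v, rfl⟩ := isEdgeVec_iff.1 hH
    rw [relabel_encVec, preimage_singleton_perm]
    exact Or.inr (Or.inl (isEdgeVec_encVec _ _))
  · obtain ⟨v, hv, rfl⟩ := isPgonVec_iff.1 hH
    rw [relabel_encVec, Set.preimage_empty]
    exact Or.inr (Or.inr (isPgonVec_encVec.2 (hf v hv)))

/-- A dihedral symmetry of the index cycle taking one vertex-edge flag to another. -/
theorem exists_dihedral {k l k' l' : ZMod p} (hl : l ∈ ({k, k + 1} : Set (ZMod p)))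
    (hl' : l' ∈ ({k', k' + 1} : Set (ZMod p))) :
    ∃ σ : Equiv.Perm (ZMod p), (∀ k, ∃ m, σ ⁻¹' {k, k + 1} = ({m, m + 1} : Set (ZMod p))) ∧
      σ ⁻¹' {k, k + 1} = {k', k' + 1} ∧ σ ⁻¹' {l} = {l'} := by
  have hrot (c k : ZMod p) : Equiv.addRight c ⁻¹' {k, k + 1} = ({k - c, k - c + 1} : Set _) := by
    ext i
    simp only [Set.mem_preimage, Equiv.coe_addRight, Set.mem_insert_iff, Set.mem_singleton_iff]
    grind
  have href (c k : ZMod p) :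
      Equiv.subLeft c ⁻¹' {k, k + 1} = ({c - k - 1, c - k - 1 + 1} : Set _) := by
    ext i
    simp only [Set.mem_preimage, Equiv.subLeft_apply, Set.mem_insert_iff, Set.mem_singleton_iff]
    grind
  have hcases : l - k = l' - k' ∨ l + l' = k + k' + 1 := by
    simp only [Set.mem_insert_iff, Set.mem_singleton_iff] at hl hl'
    grind
  rcases hcases with h | h
  · refine ⟨Equiv.addRight (k - k'), fun m => ⟨_, hrot _ m⟩, by rw [hrot]; simp, ?_⟩
    ext i
    simp only [Set.mem_preimage, Equiv.coe_addRight, Set.mem_singleton_iff]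
    grind
  · refine ⟨Equiv.subLeft (k + k' + 1), fun m => ⟨_, href _ m⟩, ?_, ?_⟩
    · rw [href, show k + k' + 1 - k - 1 = k' by ring]
    · ext i
      simp only [Set.mem_preimage, Equiv.subLeft_apply, Set.mem_singleton_iff]
      grind

/-- Label permutations `x ↦ ± x + d i` taking one `p`-gon to another and preserving the condition
on sums. -/
theorem exists_label_perm [NeZero p] (σ : Equiv.Perm (ZMod p)) {v w : ZMod p → ZMod q}
    (hv : ∑ i, v i = 0 ∨ ∑ i, v i = 1) (hw : ∑ i, w i = 0 ∨ ∑ i, w i = 1) :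
    ∃ f : ZMod p → Equiv.Perm (ZMod q), (∀ i, f i (v (σ i)) = w i) ∧
      ∀ u : ZMod p → ZMod q, ∑ i, u i = 0 ∨ ∑ i, u i = 1 →
        ∑ i, f i (u (σ i)) = 0 ∨ ∑ i, f i (u (σ i)) = 1 := by
  have hcases : ∑ i, v i = ∑ i, w i ∨ ∑ i, v i + ∑ i, w i = 1 := by
    grind
  rcases hcases with h | h
  · refine ⟨fun i => Equiv.addRight (w i - v (σ i)), fun i => by simp, fun u hu => ?_⟩
    simpa [Finset.sum_add_distrib, Finset.sum_sub_distrib, Equiv.sum_comp σ, h] using hu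
  · refine ⟨fun i => Equiv.subLeft (w i + v (σ i)), fun i => by simp, fun u hu => ?_⟩
    simp only [Equiv.subLeft_apply, Finset.sum_add_distrib, Finset.sum_sub_distrib,
      Equiv.sum_comp σ]
    grind

theorem exists_flag_automorphism [NeZero p] [NeZero q] {V E G V' E' G' : ZMod p → Set (ZMod q)}
    (hV : IsVertVec p q V) (hE : IsEdgeVec p q E) (hG : IsPgonVec p q G)
    (hV' : IsVertVec p q V') (hE' : IsEdgeVec p q E') (hG' : IsPgonVec p q G')
    (hVE : faceIncl V E) (hEG : faceIncl E G) (hVE' : faceIncl V' E') (hEG' : faceIncl E' G') :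
    ∃ φ : sigmaFaces p q ≃ sigmaFaces p q,
      (∀ X Y : sigmaFaces p q, faceIncl X.1 Y.1 ↔ faceIncl (φ X).1 (φ Y).1) ∧
      φ ⟨V, Or.inl hV⟩ = ⟨V', Or.inl hV'⟩ ∧
      φ ⟨E, Or.inr (Or.inl hE)⟩ = ⟨E', Or.inr (Or.inl hE')⟩ ∧
      φ ⟨G, Or.inr (Or.inr hG)⟩ = ⟨G', Or.inr (Or.inr hG')⟩ := by
  obtain ⟨v, hv, rfl⟩ := isPgonVec_iff.1 hG
  obtain ⟨w, hw, rfl⟩ := isPgonVec_iff.1 hG'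
  obtain ⟨l, rfl⟩ := isEdgeVec_and_faceIncl_iff.1 ⟨hE, hEG⟩
  obtain ⟨l', rfl⟩ := isEdgeVec_and_faceIncl_iff.1 ⟨hE', hEG'⟩
  obtain ⟨k, hl, rfl⟩ := isVertVec_and_faceIncl_iff.1 ⟨hV, hVE⟩
  obtain ⟨k', hl', rfl⟩ := isVertVec_and_faceIncl_iff.1 ⟨hV', hVE'⟩
  obtain ⟨σ, hσ, hσk, hσl⟩ :=
    exists_dihedral (Set.singleton_subset_iff.1 hl) (Set.singleton_subset_iff.1 hl')
  obtain ⟨f, hf, hfsum⟩ := exists_label_perm σ hv hw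
  let φ : sigmaFaces p q → sigmaFaces p q := fun X =>
    ⟨relabel σ f X.1, relabel_mem_sigmaFaces hσ hfsum X.2⟩
  have hφ : Function.Bijective φ := Finite.injective_iff_bijective.1 fun X Y h =>
    Subtype.ext (relabel_injective σ f (congrArg Subtype.val h))
  refine ⟨Equiv.ofBijective φ hφ, fun X Y => (faceIncl_relabel_iff σ f).symm, Subtype.ext ?_,
    Subtype.ext ?_, Subtype.ext ?_⟩
  · exact (relabel_encVec _ _ _ _).trans (by rw [hσk, funext hf])
  · exact (relabel_encVec _ _ _ _).trans (by rw [hσl, funext hf])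
  · exact (relabel_encVec _ _ _ _).trans (by rw [Set.preimage_empty, funext hf])

/-! ### Orientability -/

/-- Make full every entry following a full entry. -/
def fillNext (H : ZMod p → Set (ZMod q)) : ZMod p → Set (ZMod q) :=
  fun i => {x | H (i - 1) = Set.univ ∨ x ∈ H i}

/-- Make full every entry preceding a full entry. -/
def fillPrev (H : ZMod p → Set (ZMod q)) : ZMod p → Set (ZMod q) :=
  fun i => {x | H (i + 1) = Set.univ ∨ x ∈ H i}

theorem fillNext_encVec (k : ZMod p) (v : ZMod p → ZMod q) :
    fillNext (encVec {k} v) = encVec {k, k + 1} v := by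
  funext i
  ext x
  simp only [fillNext, encVec_eq_univ_iff]
  simp only [Set.mem_ofPred_eq, encVec, Set.mem_singleton_iff,
    Set.mem_insert_iff, sub_eq_iff_eq_add]
  tauto

theorem fillPrev_encVec (k : ZMod p) (v : ZMod p → ZMod q) :
    fillPrev (encVec {k} v) = encVec {k - 1, k - 1 + 1} v := by
  funext i
  ext x
  simp only [fillPrev, encVec_eq_univ_iff]
  simp only [Set.mem_ofPred_eq, encVec, Set.mem_singleton_iff,
    Set.mem_insert_iff, ← eq_sub_iff_add_eq, sub_add_cancel]
  tauto

open Classical in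
/-- The direction of the edge `E` induced by the orientation of the `p`-gon `G`. -/
def edgeDirection [NeZero p] (E G : ZMod p → Set (ZMod q)) :
    (ZMod p → Set (ZMod q)) × (ZMod p → Set (ZMod q)) :=
  if ∃ v : ZMod p → ZMod q, ∑ i, v i = 0 ∧ G = encVec ∅ v then (fillPrev E, fillNext E)
  else (fillNext E, fillPrev E)

theorem edgeDirection_of_sum_eq_zero [NeZero p] (E : ZMod p → Set (ZMod q)) {v : ZMod p → ZMod q}
    (hv : ∑ i, v i = 0) : edgeDirection E (encVec ∅ v) = (fillPrev E, fillNext E) :=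
  if_pos ⟨v, hv, rfl⟩

theorem edgeDirection_of_sum_eq_one [NeZero p] (hq : 2 ≤ q) (E : ZMod p → Set (ZMod q))
    {v : ZMod p → ZMod q} (hv : ∑ i, v i = 1) :
    edgeDirection E (encVec ∅ v) = (fillNext E, fillPrev E) :=
  if_neg fun ⟨w, hw, h⟩ => zmod_one_ne_zero hq (by
    rw [← hv, encVec_empty_injective h, hw])

theorem existsUnique_fillNext_eq (hp : 3 ≤ p) {V : ZMod p → Set (ZMod q)} {v : ZMod p → ZMod q}
    (hV : IsVertVec p q V) (h : faceIncl V (encVec ∅ v)) :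
    ∃! E, IsEdgeVec p q E ∧ faceIncl V E ∧ faceIncl E (encVec ∅ v) ∧ fillNext E = V := by
  obtain ⟨k, -, rfl⟩ := isVertVec_and_faceIncl_iff.1 ⟨hV, h⟩
  refine ⟨encVec {k} v, ⟨isEdgeVec_encVec k v, faceIncl_encVec_iff.2 ⟨by simp, fun _ _ => rfl⟩,
    faceIncl_encVec_iff.2 ⟨by simp, fun _ _ => rfl⟩, fillNext_encVec k v⟩, ?_⟩
  rintro E ⟨hE, -, hEG, hnext⟩
  obtain ⟨l, rfl⟩ := isEdgeVec_and_faceIncl_iff.1 ⟨hE, hEG⟩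
  rw [fillNext_encVec] at hnext
  rw [pair_add_one_injective hp (encVec_inj.1 hnext).1]

theorem existsUnique_fillPrev_eq (hp : 3 ≤ p) {V : ZMod p → Set (ZMod q)} {v : ZMod p → ZMod q}
    (hV : IsVertVec p q V) (h : faceIncl V (encVec ∅ v)) :
    ∃! E, IsEdgeVec p q E ∧ faceIncl V E ∧ faceIncl E (encVec ∅ v) ∧ fillPrev E = V := by
  obtain ⟨k, -, rfl⟩ := isVertVec_and_faceIncl_iff.1 ⟨hV, h⟩
  refine ⟨encVec {k + 1} v, ⟨isEdgeVec_encVec _ v,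
    faceIncl_encVec_iff.2 ⟨by simp, fun _ _ => rfl⟩,
    faceIncl_encVec_iff.2 ⟨by simp, fun _ _ => rfl⟩,
    by rw [fillPrev_encVec, add_sub_cancel_right]⟩, ?_⟩
  rintro E ⟨hE, -, hEG, hprev⟩
  obtain ⟨l, rfl⟩ := isEdgeVec_and_faceIncl_iff.1 ⟨hE, hEG⟩
  rw [fillPrev_encVec] at hprev
  rw [← pair_add_one_injective hp (encVec_inj.1 hprev).1, sub_add_cancel]

theorem fillPrev_ne_fillNext (hp : 3 ≤ p) {E : ZMod p → Set (ZMod q)} (hE : IsEdgeVec p q E) :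
    fillPrev E ≠ fillNext E := by
  obtain ⟨k, v, rfl⟩ := isEdgeVec_iff.1 hE
  rw [fillPrev_encVec, fillNext_encVec]
  intro h
  have := pair_add_one_injective hp (encVec_inj.1 h).1
  exact zmod_one_ne_zero (p := p) (by omega) (by linear_combination -this)

theorem isVertVec_fillNext {E : ZMod p → Set (ZMod q)} (hE : IsEdgeVec p q E) :
    IsVertVec p q (fillNext E) := by
  obtain ⟨k, v, rfl⟩ := isEdgeVec_iff.1 hE
  exact fillNext_encVec k v ▸ isVertVec_encVec k v

theorem isVertVec_fillPrev {E : ZMod p → Set (ZMod q)} (hE : IsEdgeVec p q E) :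
    IsVertVec p q (fillPrev E) := by
  obtain ⟨k, v, rfl⟩ := isEdgeVec_iff.1 hE
  exact fillPrev_encVec k v ▸ isVertVec_encVec (k - 1) v

theorem faceIncl_fillNext (H : ZMod p → Set (ZMod q)) : faceIncl (fillNext H) H :=
  fun _ _ => Or.inr

theorem faceIncl_fillPrev (H : ZMod p → Set (ZMod q)) : faceIncl (fillPrev H) H :=
  fun _ _ => Or.inr

/-- `edgeDirection` is a coherent orientation of the surface. -/
theorem edgeDirection_coherent [NeZero p] (hp : 3 ≤ p) (hq : 2 ≤ q) :
    (∀ E G, IsEdgeVec p q E → IsPgonVec p q G → faceIncl E G →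
      IsVertVec p q (edgeDirection E G).1 ∧ IsVertVec p q (edgeDirection E G).2 ∧
      faceIncl (edgeDirection E G).1 E ∧ faceIncl (edgeDirection E G).2 E ∧
      (edgeDirection E G).1 ≠ (edgeDirection E G).2) ∧
    (∀ E G G', IsEdgeVec p q E → IsPgonVec p q G → IsPgonVec p q G' → G ≠ G' →
      faceIncl E G → faceIncl E G' →
      (edgeDirection E G).1 = (edgeDirection E G').2 ∧
      (edgeDirection E G).2 = (edgeDirection E G').1) ∧
    (∀ G V, IsPgonVec p q G → IsVertVec p q V → faceIncl V G →
      (∃! E, IsEdgeVec p q E ∧ faceIncl V E ∧ faceIncl E G ∧ (edgeDirection E G).1 = V) ∧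
      (∃! E, IsEdgeVec p q E ∧ faceIncl V E ∧ faceIncl E G ∧ (edgeDirection E G).2 = V)) := by
  refine ⟨fun E G hE hG _ => ?_, fun E G G' hE hG hG' hne hEG hEG' => ?_, fun G V hG hV hVG => ?_⟩
  · obtain ⟨v, hv | hv, rfl⟩ := isPgonVec_iff.1 hG
    · rw [edgeDirection_of_sum_eq_zero E hv]
      exact ⟨isVertVec_fillPrev hE, isVertVec_fillNext hE, faceIncl_fillPrev E,
        faceIncl_fillNext E, fillPrev_ne_fillNext hp hE⟩
    · rw [edgeDirection_of_sum_eq_one hq E hv]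
      exact ⟨isVertVec_fillNext hE, isVertVec_fillPrev hE, faceIncl_fillNext E,
        faceIncl_fillPrev E, (fillPrev_ne_fillNext hp hE).symm⟩
  · obtain ⟨k, v', rfl⟩ := isEdgeVec_iff.1 hE
    obtain ⟨v, h, hv⟩ := exists_encVec_eq_sum_zero (Set.mem_singleton k) v'
    rw [h] at hEG hEG' ⊢
    have hv' : ∑ i, (v + Pi.single k 1 : ZMod p → ZMod q) i = 1 := by
      rw [sum_add_single, hv, zero_add]
    rcases (isPgonVec_and_faceIncl_edge_iff hv).1 ⟨hG, hEG⟩ with rfl | rfl <;>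
      rcases (isPgonVec_and_faceIncl_edge_iff hv).1 ⟨hG', hEG'⟩ with rfl | rfl
    · exact (hne rfl).elim
    · rw [edgeDirection_of_sum_eq_zero _ hv, edgeDirection_of_sum_eq_one hq _ hv']
      exact ⟨rfl, rfl⟩
    · rw [edgeDirection_of_sum_eq_zero _ hv, edgeDirection_of_sum_eq_one hq _ hv']
      exact ⟨rfl, rfl⟩
    · exact (hne rfl).elim
  · obtain ⟨v, hv | hv, rfl⟩ := isPgonVec_iff.1 hG
    · simp only [edgeDirection_of_sum_eq_zero _ hv]
      exact ⟨existsUnique_fillPrev_eq hp hV hVG, existsUnique_fillNext_eq hp hV hVG⟩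
    · simp only [edgeDirection_of_sum_eq_one hq _ hv]
      exact ⟨existsUnique_fillNext_eq hp hV hVG, existsUnique_fillPrev_eq hp hV hVG⟩

/-- For `p ≥ 3`, `q ≥ 2`, the subcomplex `Σ_{p,2q}` of
`W_{p,q-1} = C_p ⋈ Δ_{q-1}` is a closed connected orientable combinatorially regular
2-manifold, equivelar of type `{p, 2q}`, with f-vector
`(p·q^{p-2}, p·q^{p-1}, 2·q^{p-1})` and genus `1 + q^{p-2}(pq - p - 2q)/2`. -/
theorem sigmaSurface_closed_connected_orientable_regular_manifold
    (p q : ℕ) [NeZero p] [NeZero q] (hp : 3 ≤ p) (hq : 2 ≤ q) :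
    -- f-vector:
    ({H | IsVertVec p q H}.ncard = p * q ^ (p - 2) ∧
     {H | IsEdgeVec p q H}.ncard = p * q ^ (p - 1) ∧
     {H | IsPgonVec p q H}.ncard = 2 * q ^ (p - 1)) ∧
    -- equivelar of type {p, 2q}: every 2-face has p vertices, every vertex degree 2q:
    ((∀ G, IsPgonVec p q G → {V | IsVertVec p q V ∧ faceIncl V G}.ncard = p) ∧
     (∀ G, IsPgonVec p q G → {E | IsEdgeVec p q E ∧ faceIncl E G}.ncard = p) ∧
     (∀ V, IsVertVec p q V → {E | IsEdgeVec p q E ∧ faceIncl V E}.ncard = 2 * q) ∧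
     (∀ V, IsVertVec p q V → {G | IsPgonVec p q G ∧ faceIncl V G}.ncard = 2 * q)) ∧
    -- closed 2-manifold: every edge lies in exactly two 2-faces and has two vertices,
    ((∀ E, IsEdgeVec p q E → {G | IsPgonVec p q G ∧ faceIncl E G}.ncard = 2) ∧
     (∀ E, IsEdgeVec p q E → {V | IsVertVec p q V ∧ faceIncl V E}.ncard = 2) ∧
     -- and the link of every vertex is a single cycle (of length 2q):
     (∀ V, IsVertVec p q V →
        ∃ e g : ZMod (2 * q) → (ZMod p → Set (ZMod q)),
          Function.Injective e ∧ Function.Injective g ∧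
          (∀ t, IsEdgeVec p q (e t) ∧ faceIncl V (e t)) ∧
          (∀ t, IsPgonVec p q (g t) ∧ faceIncl V (g t)) ∧
          (∀ E', IsEdgeVec p q E' → faceIncl V E' → ∃ t, E' = e t) ∧
          (∀ G', IsPgonVec p q G' → faceIncl V G' → ∃ t, G' = g t) ∧
          (∀ t, faceIncl (e t) (g t) ∧ faceIncl (e (t + 1)) (g t)))) ∧
    -- connected:
    (∀ G G', IsPgonVec p q G → IsPgonVec p q G' →
      ∃ (n : ℕ) (c : Fin (n + 1) → (ZMod p → Set (ZMod q))),
        (∀ k, IsPgonVec p q (c k)) ∧ c 0 = G ∧ c (Fin.last n) = G' ∧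
        ∀ k : Fin n, ∃ E, IsEdgeVec p q E ∧
          faceIncl E (c k.castSucc) ∧ faceIncl E (c k.succ)) ∧
    -- combinatorially regular (flag-transitive):
    (∀ V E G V' E' G' : ZMod p → Set (ZMod q),
      ∀ (hV : IsVertVec p q V) (hE : IsEdgeVec p q E) (hG : IsPgonVec p q G)
        (hV' : IsVertVec p q V') (hE' : IsEdgeVec p q E') (hG' : IsPgonVec p q G'),
      faceIncl V E → faceIncl E G → faceIncl V' E' → faceIncl E' G' →
      ∃ φ : sigmaFaces p q ≃ sigmaFaces p q,
        (∀ X Y : sigmaFaces p q, faceIncl X.1 Y.1 ↔ faceIncl (φ X).1 (φ Y).1) ∧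
        φ ⟨V, Or.inl hV⟩ = ⟨V', Or.inl hV'⟩ ∧
        φ ⟨E, Or.inr (Or.inl hE)⟩ = ⟨E', Or.inr (Or.inl hE')⟩ ∧
        φ ⟨G, Or.inr (Or.inr hG)⟩ = ⟨G', Or.inr (Or.inr hG')⟩) ∧
    -- orientable: there is a coherent choice of directions of the edge–face incidences:
    (∃ D : (ZMod p → Set (ZMod q)) → (ZMod p → Set (ZMod q)) →
          ((ZMod p → Set (ZMod q)) × (ZMod p → Set (ZMod q))),
      (∀ E G, IsEdgeVec p q E → IsPgonVec p q G → faceIncl E G →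
        IsVertVec p q (D E G).1 ∧ IsVertVec p q (D E G).2 ∧
        faceIncl (D E G).1 E ∧ faceIncl (D E G).2 E ∧ (D E G).1 ≠ (D E G).2) ∧
      (∀ E G G', IsEdgeVec p q E → IsPgonVec p q G → IsPgonVec p q G' → G ≠ G' →
        faceIncl E G → faceIncl E G' →
        (D E G).1 = (D E G').2 ∧ (D E G).2 = (D E G').1) ∧
      (∀ G V, IsPgonVec p q G → IsVertVec p q V → faceIncl V G →
        (∃! E, IsEdgeVec p q E ∧ faceIncl V E ∧ faceIncl E G ∧ (D E G).1 = V) ∧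
        (∃! E, IsEdgeVec p q E ∧ faceIncl V E ∧ faceIncl E G ∧ (D E G).2 = V))) ∧
    -- genus `g = 1 + q^{p-2}(pq - p - 2q)/2`, via the Euler characteristic:
    (∃ g : ℚ, g = 1 + (q : ℚ) ^ (p - 2) * (p * q - p - 2 * q) / 2 ∧
      (p * q ^ (p - 2) : ℚ) - p * q ^ (p - 1) + 2 * q ^ (p - 1) = 2 - 2 * g) := by
  refine ⟨⟨ncard_isVertVec hp hq, ncard_isEdgeVec hq, ncard_isPgonVec hq⟩,
    ⟨fun G => ncard_vert_of_pgon hp, fun G => ncard_edge_of_pgon,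
      fun V => ncard_edge_of_vert hp hq, fun V => ncard_pgon_of_vert hp hq⟩,
    ⟨fun E => ncard_pgon_of_edge hq, fun E => ncard_vert_of_edge hp,
      fun V => exists_link_cycle hp hq⟩,
    fun G G' hG hG' => exists_pgon_path hG' (reflTransGen_pgonAdj hG hG'),
    fun V E G V' E' G' hV hE hG hV' hE' hG' hVE hEG hVE' hEG' =>
      exists_flag_automorphism hV hE hG hV' hE' hG' hVE hEG hVE' hEG',
    ⟨edgeDirection, edgeDirection_coherent hp hq⟩,
    ⟨_, rfl, ?_⟩⟩
  rw [show p - 1 = p - 2 + 1 by omega, pow_succ]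
  ring
end
end
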